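/- arXiv:1211.5657 — 5 statements merged into one kernel-verified Lean document; each statement's English description precedes it below -/
import Mathlib

section
/- Let λ > 0, β > 0, and suppose f:[0,1]→ℝ satisfies f(0)=0, f(1)=1, f(r)>0 and f'(r)>0 for r ∈ (0,1], and that u_λ(x) := f(|x|)·exp(i·θ(x)), where θ(x)=arg(x₁+ix₂), is a C² solution of −Δu = λ(1−|u|²)u on the open unit disk with u(x)=x₁+ix₂ for |x|=1. If Ψ=(ψ₊,ψ₋) is a solution of the Dirichlet problem (DP) with ψ₊(0)=0 and ψ₋(0)=0, then ψ₊ = ψ₋ = (1/√2)·u_λ on the closed unit disk. -/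
open MeasureTheory Metric Set Filter Complex

noncomputable section

/-- The Laplacian of `f : ℂ → ℂ` (plane identified with `ℂ`). -/
def lap (f : ℂ → ℂ) (x : ℂ) : ℂ :=
  fderiv ℝ (fun y => fderiv ℝ f y 1) x 1 + fderiv ℝ (fun y => fderiv ℝ f y Complex.I) x Complex.I

/-- `Ψ = (ψ₊,ψ₋)` is a solution of the Dirichlet problem (DP) on the unit disk:
continuous on the closed disk, `C²` on the open disk, solving the two-component
Ginzburg–Landau system with parameters `λ, β`, with symmetric degree-one boundary data. -/
def DPSolution (lam β : ℝ) (ψp ψm : ℂ → ℂ) : Prop :=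
  ContinuousOn ψp (closedBall 0 1) ∧ ContinuousOn ψm (closedBall 0 1) ∧
  ContDiffOn ℝ 2 ψp (ball 0 1) ∧ ContDiffOn ℝ 2 ψm (ball 0 1) ∧
  (∀ x ∈ ball (0 : ℂ) 1,
    -lap ψp x =
      (lam : ℂ) * ((1 - (‖ψp x‖ ^ 2 + ‖ψm x‖ ^ 2) : ℝ) : ℂ) * ψp x
        + (lam : ℂ) * (β : ℂ) * ((‖ψm x‖ ^ 2 - ‖ψp x‖ ^ 2 : ℝ) : ℂ) * ψp x ∧
    -lap ψm x =
      (lam : ℂ) * ((1 - (‖ψp x‖ ^ 2 + ‖ψm x‖ ^ 2) : ℝ) : ℂ) * ψm x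
        - (lam : ℂ) * (β : ℂ) * ((‖ψm x‖ ^ 2 - ‖ψp x‖ ^ 2 : ℝ) : ℂ) * ψm x) ∧
  (∀ x : ℂ, ‖x‖ = 1 →
    ψp x = (Real.sqrt 2 : ℂ)⁻¹ * x ∧ ψm x = (Real.sqrt 2 : ℂ)⁻¹ * x)

open scoped Topology

lemma continuous_slice {F : Type*} [TopologicalSpace F] {p : ℝ → ℝ → F}
    (hp : ContinuousOn (Function.uncurry p) (Iio 0 ×ˢ univ)) {s : ℝ} (hs : s < 0) :
    Continuous (p s) := by
  have : Continuous fun θ : ℝ => Function.uncurry p (s, θ) :=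
    hp.comp_continuous (by fun_prop) (fun θ => ⟨hs, mem_univ _⟩)
  exact this

/-- Differentiation under the integral over one period, on the half-cylinder `t < 0`. -/
lemma hasDerivAt_integral_halfCylinder {q q' : ℝ → ℝ → ℝ}
    (hq : ContinuousOn (Function.uncurry q) (Iio 0 ×ˢ univ))
    (hq' : ContinuousOn (Function.uncurry q') (Iio 0 ×ˢ univ))
    (hd : ∀ t < 0, ∀ θ, HasDerivAt (fun s => q s θ) (q' t θ) t) {t : ℝ} (ht : t < 0) :
    HasDerivAt (fun s => ∫ θ in (0 : ℝ)..2 * Real.pi, q s θ)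
      (∫ θ in (0 : ℝ)..2 * Real.pi, q' t θ) t := by
  have hK : IsCompact (Icc (2 * t) (t / 2) ×ˢ Icc (0 : ℝ) (2 * Real.pi)) :=
    isCompact_Icc.prod isCompact_Icc
  obtain ⟨C, hC⟩ := hK.exists_bound_of_continuousOn (hq'.mono (by
    rintro ⟨a, b⟩ ⟨ha, -⟩
    exact ⟨by simp only [mem_Iio]; linarith [ha.2], mem_univ _⟩))
  have hnhds : Ioo (2 * t) (t / 2) ∈ 𝓝 t := Ioo_mem_nhds (by linarith) (by linarith)
  refine (intervalIntegral.hasDerivAt_integral_of_dominated_loc_of_deriv_le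
    (F := q) (F' := q') (bound := fun _ => C) hnhds ?_ ?_ ?_ ?_ ?_ ?_).2
  · filter_upwards [Iio_mem_nhds ht] with s hs
    exact (continuous_slice hq hs).aestronglyMeasurable
  · exact (continuous_slice hq ht).intervalIntegrable _ _
  · exact (continuous_slice hq' ht).aestronglyMeasurable
  · refine ae_of_all _ fun θ hθ s hs => ?_
    rw [uIoc_of_le (by positivity)] at hθ
    exact hC (s, θ) ⟨⟨hs.1.le, hs.2.le⟩, ⟨hθ.1.le, hθ.2⟩⟩
  · exact intervalIntegrable_const
  · refine ae_of_all _ fun θ _ s hs => hd s (by linarith [hs.2]) θ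

/-- A `C²` function on the half-cylinder `t < 0`, `θ ∈ ℝ / 2πℤ`, with its partial derivatives. -/
structure HalfCylinderC2 {E : Type*} [NormedAddCommGroup E] [NormedSpace ℝ E]
    (V Vt Vθ Vtt Vtθ Vθθ : ℝ → ℝ → E) : Prop where
  cV : ContinuousOn (Function.uncurry V) (Iio 0 ×ˢ univ)
  cVt : ContinuousOn (Function.uncurry Vt) (Iio 0 ×ˢ univ)
  cVθ : ContinuousOn (Function.uncurry Vθ) (Iio 0 ×ˢ univ)
  cVtt : ContinuousOn (Function.uncurry Vtt) (Iio 0 ×ˢ univ)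
  cVtθ : ContinuousOn (Function.uncurry Vtθ) (Iio 0 ×ˢ univ)
  cVθθ : ContinuousOn (Function.uncurry Vθθ) (Iio 0 ×ˢ univ)
  dt : ∀ t < 0, ∀ θ, HasDerivAt (fun s => V s θ) (Vt t θ) t
  dθ : ∀ t < 0, ∀ θ, HasDerivAt (V t) (Vθ t θ) θ
  dtt : ∀ t < 0, ∀ θ, HasDerivAt (fun s => Vt s θ) (Vtt t θ) t
  dtθ : ∀ t < 0, ∀ θ, HasDerivAt (fun s => Vθ s θ) (Vtθ t θ) t
  dθt : ∀ t < 0, ∀ θ, HasDerivAt (Vt t) (Vtθ t θ) θ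
  dθθ : ∀ t < 0, ∀ θ, HasDerivAt (Vθ t) (Vθθ t θ) θ
  pV : ∀ t < 0, V t (2 * Real.pi) = V t 0
  pVt : ∀ t < 0, Vt t (2 * Real.pi) = Vt t 0
  pVθ : ∀ t < 0, Vθ t (2 * Real.pi) = Vθ t 0

lemma sq_integral_inner_le {E : Type*} [NormedAddCommGroup E] [InnerProductSpace ℝ E]
    {x y : ℝ → E} (hx : Continuous x) (hy : Continuous y) {a b : ℝ} (hab : a ≤ b) :
    (∫ θ in a..b, inner ℝ (x θ) (y θ)) ^ 2
      ≤ (∫ θ in a..b, ‖x θ‖ ^ 2) * ∫ θ in a..b, ‖y θ‖ ^ 2 := by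
  have key : ∀ s : ℝ, 0 ≤ (∫ θ in a..b, ‖y θ‖ ^ 2) * (s * s)
      + (2 * ∫ θ in a..b, inner ℝ (x θ) (y θ)) * s + ∫ θ in a..b, ‖x θ‖ ^ 2 := by
    intro s
    have h : 0 ≤ ∫ θ in a..b, ‖x θ + s • y θ‖ ^ 2 :=
      intervalIntegral.integral_nonneg hab fun θ _ => by positivity
    have h2 : (∫ θ in a..b, ‖x θ + s • y θ‖ ^ 2)
        = (∫ θ in a..b, ‖y θ‖ ^ 2) * (s * s)
      + (2 * ∫ θ in a..b, inner ℝ (x θ) (y θ)) * s + ∫ θ in a..b, ‖x θ‖ ^ 2 := by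
      rw [← intervalIntegral.integral_mul_const, ← intervalIntegral.integral_const_mul,
        ← intervalIntegral.integral_mul_const, ← intervalIntegral.integral_add,
        ← intervalIntegral.integral_add]
      · refine intervalIntegral.integral_congr fun θ _ => ?_
        simp only [norm_add_sq_real, inner_smul_right, norm_smul, Real.norm_eq_abs, mul_pow,
          sq_abs]
        ring
      all_goals exact Continuous.intervalIntegrable (by fun_prop) _ _
    rwa [h2] at h
  have := discrim_le_zero key
  unfold discrim at this
  nlinarith

/-- A positive function that is log-convex with respect to a weight bounded below cannot tend to
zero at the right end of an interval. -/
lemma not_tendsto_zero_of_weighted_log_convex {h h' ρ w : ℝ → ℝ} {t₀ ρ₀ : ℝ} (ht₀ : t₀ < 0)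
    (hρ₀ : 0 < ρ₀) (hρ : ∀ t ∈ Ico t₀ 0, ρ₀ ≤ ρ t) (hpos : ∀ t ∈ Ico t₀ 0, 0 < h t)
    (hd : ∀ t ∈ Ico t₀ 0, HasDerivAt h (h' t) t)
    (hdd : ∀ t ∈ Ico t₀ 0, HasDerivAt (fun s => ρ s * h' s) (w t) t)
    (hw : ∀ t ∈ Ico t₀ 0, ρ t * h' t ^ 2 ≤ w t * h t) :
    ¬ Tendsto h (𝓝[<] 0) (𝓝 0) := by
  intro hlim
  have hq : ∀ t ∈ Ico t₀ 0, HasDerivAt (fun s => ρ s * h' s / h s)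
      ((w t * h t - ρ t * h' t * h' t) / h t ^ 2) t := fun t ht =>
    (hdd t ht).div (hd t ht) (hpos t ht).ne'
  have hmono : MonotoneOn (fun s => ρ s * h' s / h s) (Ico t₀ 0) := by
    refine monotoneOn_of_deriv_nonneg (convex_Ico _ _)
      (fun t ht => (hq t ht).continuousAt.continuousWithinAt) ?_ ?_
    · intro t ht
      exact (hq t (interior_subset ht)).differentiableAt.differentiableWithinAt
    · intro t ht
      rw [(hq t (interior_subset ht)).deriv]
      have := hw t (interior_subset ht)
      exact div_nonneg (by nlinarith) (by positivity)
  set Q := ρ t₀ * h' t₀ / h t₀ with hQ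
  have hl : ∀ t ∈ Ico t₀ 0, HasDerivAt (fun s => Real.log (h s) + |Q| / ρ₀ * s)
      (h' t / h t + |Q| / ρ₀ * 1) t := fun t ht =>
    ((hd t ht).log (hpos t ht).ne').add ((hasDerivAt_id t).const_mul _)
  have hmono2 : MonotoneOn (fun s => Real.log (h s) + |Q| / ρ₀ * s) (Ico t₀ 0) := by
    refine monotoneOn_of_deriv_nonneg (convex_Ico _ _)
      (fun t ht => (hl t ht).continuousAt.continuousWithinAt) ?_ ?_
    · intro t ht
      exact (hl t (interior_subset ht)).differentiableAt.differentiableWithinAt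
    · intro t ht
      have ht' := interior_subset ht
      rw [(hl t ht').deriv]
      have h1 : Q ≤ ρ t * h' t / h t := hmono ⟨le_rfl, ht₀⟩ ht' ht'.1
      have h2 : ρ t * h' t / h t = ρ t * (h' t / h t) := by ring
      rw [h2] at h1
      have hρt := hρ t ht'
      have h3 : 0 ≤ |Q| / ρ₀ := by positivity
      have h4 : |Q| / ρ₀ * ρ₀ = |Q| := by field_simp
      have h5 : -|Q| ≤ Q := neg_abs_le Q
      by_contra hneg
      push Not at hneg
      have h6 : ρ t * (h' t / h t) + ρ t * (|Q| / ρ₀) < 0 := by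
        have : ρ t * (h' t / h t + |Q| / ρ₀ * 1) < 0 :=
          mul_neg_of_pos_of_neg (by linarith) hneg
        linarith
      nlinarith
  set L := Real.log (h t₀) + |Q| / ρ₀ * t₀
  have hlow : ∀ t ∈ Ico t₀ 0, Real.exp L ≤ h t := by
    intro t ht
    have h1 : L ≤ Real.log (h t) + |Q| / ρ₀ * t := hmono2 ⟨le_rfl, ht₀⟩ ht ht.1
    have h2 : |Q| / ρ₀ * t ≤ 0 := mul_nonpos_of_nonneg_of_nonpos (by positivity) ht.2.le
    rw [← Real.exp_log (hpos t ht)]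
    exact Real.exp_le_exp.2 (by linarith)
  have hev : ∀ᶠ t in 𝓝[<] (0 : ℝ), Real.exp L ≤ h t := by
    filter_upwards [Ico_mem_nhdsLT ht₀] with t ht using hlow t ht
  exact absurd (ge_of_tendsto hlim hev) (not_le.2 (Real.exp_pos L))

namespace HalfCylinderC2

variable {E : Type*} [NormedAddCommGroup E] [InnerProductSpace ℝ E]
  {V Vt Vθ Vtt Vtθ Vθθ : ℝ → ℝ → E}

lemma integral_inner_Vθ_Vtθ (hV : HalfCylinderC2 V Vt Vθ Vtt Vtθ Vθθ) {t : ℝ} (ht : t < 0) :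
    ∫ θ in (0 : ℝ)..2 * Real.pi, inner ℝ (Vθ t θ) (Vtθ t θ)
      = -∫ θ in (0 : ℝ)..2 * Real.pi, inner ℝ (Vθθ t θ) (Vt t θ) := by
  have c1 := continuous_slice hV.cVθ ht
  have c2 := continuous_slice hV.cVtθ ht
  have c3 := continuous_slice hV.cVθθ ht
  have c4 := continuous_slice hV.cVt ht
  have h := intervalIntegral.integral_eq_sub_of_hasDerivAt (a := 0) (b := 2 * Real.pi)
    (f := fun θ => inner ℝ (Vθ t θ) (Vt t θ))
    (fun θ _ => (hV.dθθ t ht θ).inner ℝ (hV.dθt t ht θ))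
    (Continuous.intervalIntegrable (by fun_prop) _ _)
  rw [hV.pVθ t ht, hV.pVt t ht, sub_self, intervalIntegral.integral_add] at h
  · linarith
  all_goals exact Continuous.intervalIntegrable (by fun_prop) _ _

lemma integral_inner_sub_Vθθ (hV : HalfCylinderC2 V Vt Vθ Vtt Vtθ Vθθ) {e e' : ℝ → E}
    (he : ∀ θ, HasDerivAt e (e' θ) θ) (he' : ∀ θ, HasDerivAt e' (-e θ) θ)
    (pe : e (2 * Real.pi) = e 0) (pe' : e' (2 * Real.pi) = e' 0) {t : ℝ} (ht : t < 0) :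
    ∫ θ in (0 : ℝ)..2 * Real.pi, inner ℝ (V t θ - e θ) (Vθθ t θ + V t θ)
      = -∫ θ in (0 : ℝ)..2 * Real.pi, (‖Vθ t θ‖ ^ 2 - ‖V t θ‖ ^ 2) := by
  have c1 := continuous_slice hV.cVθ ht
  have c2 := continuous_slice hV.cV ht
  have c3 := continuous_slice hV.cVθθ ht
  have c4 : Continuous e := continuous_iff_continuousAt.2 fun θ => (he θ).continuousAt
  have c5 : Continuous e' := continuous_iff_continuousAt.2 fun θ => (he' θ).continuousAt
  have h := intervalIntegral.integral_eq_sub_of_hasDerivAt (a := 0) (b := 2 * Real.pi)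
    (f := fun θ => inner ℝ (V t θ - e θ) (Vθ t θ) + inner ℝ (e' θ) (V t θ))
    (f' := fun θ => inner ℝ (V t θ - e θ) (Vθθ t θ) + inner ℝ (Vθ t θ - e' θ) (Vθ t θ)
      + (inner ℝ (e' θ) (Vθ t θ) + inner ℝ (-e θ) (V t θ)))
    (fun θ _ => (((hV.dθ t ht θ).sub (he θ)).inner ℝ (hV.dθθ t ht θ)).add
      ((he' θ).inner ℝ (hV.dθ t ht θ)))
    (Continuous.intervalIntegrable (by fun_prop) _ _)
  rw [hV.pVθ t ht, hV.pV t ht, pe, pe', sub_self] at h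
  rw [eq_neg_iff_add_eq_zero]
  refine Eq.trans ?_ h
  rw [← intervalIntegral.integral_add]
  · refine intervalIntegral.integral_congr fun θ _ => ?_
    simp only [inner_sub_left, inner_add_right, real_inner_self_eq_norm_sq, inner_neg_left]
    ring
  all_goals exact Continuous.intervalIntegrable (by fun_prop) _ _

/-- The Pohozaev-type quantity of a solution of
`φ (ΔV + V + c n(V)) + 2 φ' ∂ₜV = 0` and its derivative. -/
lemma hasDerivAt_pohozaev (hV : HalfCylinderC2 V Vt Vθ Vtt Vtθ Vθθ)
    {φ φ' c c' : ℝ → ℝ} {n : E → E} {k : E → ℝ} (hn : Continuous n) (hk : Continuous k)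
    (hkd : ∀ (γ : ℝ → E) (γ' : E) (t : ℝ), HasDerivAt γ γ' t →
      HasDerivAt (fun s => k (γ s)) (-inner ℝ (n (γ t)) γ') t)
    (hφ : ∀ t < 0, 0 < φ t)
    (hc : ∀ t < 0, HasDerivAt c (c' t) t) (hc' : ContinuousOn c' (Iio 0))
    (heq : ∀ t < 0, ∀ θ, φ t • (Vtt t θ + Vθθ t θ + V t θ + c t • n (V t θ))
      + (2 * φ' t) • Vt t θ = 0) {t : ℝ} (ht : t < 0) :
    HasDerivAt (fun t => ∫ θ in (0 : ℝ)..2 * Real.pi,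
        (‖Vt t θ‖ ^ 2 / 2 - ‖Vθ t θ‖ ^ 2 / 2 + ‖V t θ‖ ^ 2 / 2 - c t * k (V t θ)))
      (-∫ θ in (0 : ℝ)..2 * Real.pi,
        (2 * (φ' t / φ t) * ‖Vt t θ‖ ^ 2 + c' t * k (V t θ))) t := by
  have dV := hV.cV
  have dVt := hV.cVt
  have dVθ := hV.cVθ
  have dVtt := hV.cVtt
  have dVtθ := hV.cVtθ
  simp only [Function.uncurry_def] at dV dVt dVθ dVtt dVtθ
  have hfst : MapsTo (Prod.fst : ℝ × ℝ → ℝ) (Iio 0 ×ˢ univ) (Iio 0) := fun p hp => hp.1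
  have dc : ContinuousOn (fun p : ℝ × ℝ => c p.1) (Iio 0 ×ˢ univ) :=
    ContinuousOn.comp (fun s hs => (hc s hs).continuousAt.continuousWithinAt)
      continuousOn_fst hfst
  have dc' : ContinuousOn (fun p : ℝ × ℝ => c' p.1) (Iio 0 ×ˢ univ) :=
    hc'.comp continuousOn_fst hfst
  have dk : ContinuousOn (fun p : ℝ × ℝ => k (V p.1 p.2)) (Iio 0 ×ˢ univ) :=
    hk.comp_continuousOn dV
  have dn : ContinuousOn (fun p : ℝ × ℝ => n (V p.1 p.2)) (Iio 0 ×ˢ univ) :=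
    hn.comp_continuousOn dV
  have key := hasDerivAt_integral_halfCylinder
    (q := fun t θ => ‖Vt t θ‖ ^ 2 / 2 - ‖Vθ t θ‖ ^ 2 / 2 + ‖V t θ‖ ^ 2 / 2 - c t * k (V t θ))
    (q' := fun t θ => inner ℝ (Vt t θ) (Vtt t θ) - inner ℝ (Vθ t θ) (Vtθ t θ)
      + inner ℝ (V t θ) (Vt t θ) - (c' t * k (V t θ) + c t * (-inner ℝ (n (V t θ)) (Vt t θ))))
    (by
      simp only [Function.uncurry_def]
      exact ((((dVt.norm.pow 2).div_const 2).sub ((dVθ.norm.pow 2).div_const 2)).add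
        ((dV.norm.pow 2).div_const 2)).sub (dc.mul dk))
    (by
      simp only [Function.uncurry_def]
      exact (((dVt.inner dVtt).sub (dVθ.inner dVtθ)).add (dV.inner dVt)).sub
        ((dc'.mul dk).add (dc.mul (dn.inner dVt).neg)))
    (fun t ht θ => by
      have h := (((hV.dtt t ht θ).norm_sq.div_const 2).sub
        ((hV.dtθ t ht θ).norm_sq.div_const 2)).add ((hV.dt t ht θ).norm_sq.div_const 2)
      have h2 := h.sub ((hc t ht).mul (hkd _ _ _ (hV.dt t ht θ)))
      refine h2.congr_deriv ?_
      ring) ht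
  refine key.congr_deriv (Eq.symm ?_)
  have c1 := continuous_slice hV.cV ht
  have c2 := continuous_slice hV.cVt ht
  have c3 := continuous_slice hV.cVθ ht
  have c4 := continuous_slice hV.cVtt ht
  have c5 := continuous_slice hV.cVtθ ht
  have c6 := continuous_slice hV.cVθθ ht
  have i1 : (∫ θ in (0 : ℝ)..2 * Real.pi, (inner ℝ (Vt t θ) (Vtt t θ) - inner ℝ (Vθ t θ) (Vtθ t θ)
      + inner ℝ (V t θ) (Vt t θ) - (c' t * k (V t θ) + c t * (-inner ℝ (n (V t θ)) (Vt t θ)))))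
      = (∫ θ in (0 : ℝ)..2 * Real.pi, (inner ℝ (Vt t θ) (Vtt t θ)
      + inner ℝ (V t θ) (Vt t θ) - (c' t * k (V t θ) + c t * (-inner ℝ (n (V t θ)) (Vt t θ)))))
      - ∫ θ in (0 : ℝ)..2 * Real.pi, inner ℝ (Vθ t θ) (Vtθ t θ) := by
    rw [← intervalIntegral.integral_sub]
    · refine intervalIntegral.integral_congr fun θ _ => ?_
      ring
    all_goals exact Continuous.intervalIntegrable (by fun_prop) _ _
  rw [i1, hV.integral_inner_Vθ_Vtθ ht, sub_neg_eq_add, ← intervalIntegral.integral_neg,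
    ← intervalIntegral.integral_add]
  · refine intervalIntegral.integral_congr fun θ _ => ?_
    have e1 := congrArg (fun x => inner ℝ x (Vt t θ)) (heq t ht θ)
    simp only [inner_add_left, inner_smul_left, inner_zero_left, RCLike.conj_to_real,
      real_inner_self_eq_norm_sq] at e1
    have hp := hφ t ht
    rw [real_inner_comm (Vtt t θ)]
    field_simp
    linarith
  all_goals exact Continuous.intervalIntegrable (by fun_prop) _ _

lemma hasDerivAt_integral_dist_sq (hV : HalfCylinderC2 V Vt Vθ Vtt Vtθ Vθθ) {e : ℝ → E}
    (ce : Continuous e) {t : ℝ} (ht : t < 0) :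
    HasDerivAt (fun t => ∫ θ in (0 : ℝ)..2 * Real.pi, ‖V t θ - e θ‖ ^ 2)
      (∫ θ in (0 : ℝ)..2 * Real.pi, 2 * inner ℝ (V t θ - e θ) (Vt t θ)) t := by
  have dV := hV.cV
  have dVt := hV.cVt
  simp only [Function.uncurry_def] at dV dVt
  have de : ContinuousOn (fun p : ℝ × ℝ => e p.2) (Iio 0 ×ˢ univ) :=
    (ce.comp continuous_snd).continuousOn
  refine hasDerivAt_integral_halfCylinder (q := fun t θ => ‖V t θ - e θ‖ ^ 2)
    (q' := fun t θ => 2 * inner ℝ (V t θ - e θ) (Vt t θ)) ?_ ?_ ?_ ht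
  · exact (dV.sub de).norm.pow 2
  · exact continuousOn_const.mul ((dV.sub de).inner dVt)
  · intro t ht θ
    exact ((hV.dt t ht θ).sub_const (e θ)).norm_sq

lemma hasDerivAt_weighted_integral_inner (hV : HalfCylinderC2 V Vt Vθ Vtt Vtθ Vθθ)
    {φ φ' c : ℝ → ℝ} {n : E → E} (hn : Continuous n) {e : ℝ → E} (ce : Continuous e)
    (hφd : ∀ t < 0, HasDerivAt φ (φ' t) t)
    (heq : ∀ t < 0, ∀ θ, φ t • (Vtt t θ + Vθθ t θ + V t θ + c t • n (V t θ))
      + (2 * φ' t) • Vt t θ = 0) {t : ℝ} (ht : t < 0) :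
    HasDerivAt (fun t => φ t ^ 2 * ∫ θ in (0 : ℝ)..2 * Real.pi, 2 * inner ℝ (V t θ - e θ) (Vt t θ))
      (2 * φ t ^ 2 * ((∫ θ in (0 : ℝ)..2 * Real.pi, ‖Vt t θ‖ ^ 2)
        - ∫ θ in (0 : ℝ)..2 * Real.pi,
          inner ℝ (V t θ - e θ) (Vθθ t θ + V t θ + c t • n (V t θ)))) t := by
  have dV := hV.cV
  have dVt := hV.cVt
  have dVtt := hV.cVtt
  simp only [Function.uncurry_def] at dV dVt dVtt
  have de : ContinuousOn (fun p : ℝ × ℝ => e p.2) (Iio 0 ×ˢ univ) :=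
    (ce.comp continuous_snd).continuousOn
  have key := hasDerivAt_integral_halfCylinder
    (q := fun t θ => 2 * inner ℝ (V t θ - e θ) (Vt t θ))
    (q' := fun t θ => 2 * (inner ℝ (V t θ - e θ) (Vtt t θ) + inner ℝ (Vt t θ) (Vt t θ)))
    (continuousOn_const.mul ((dV.sub de).inner dVt))
    (continuousOn_const.mul (((dV.sub de).inner dVtt).add (dVt.inner dVt)))
    (fun t ht θ => (((hV.dt t ht θ).sub_const (e θ)).inner ℝ (hV.dtt t ht θ)).const_mul 2) ht
  have h := ((hφd t ht).pow 2).mul key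
  refine h.congr_deriv ?_
  have c1 := continuous_slice hV.cV ht
  have c2 := continuous_slice hV.cVt ht
  have c4 := continuous_slice hV.cVtt ht
  have c6 := continuous_slice hV.cVθθ ht
  rw [← intervalIntegral.integral_sub, ← intervalIntegral.integral_const_mul,
    ← intervalIntegral.integral_const_mul, ← intervalIntegral.integral_const_mul,
    ← intervalIntegral.integral_add]
  · refine intervalIntegral.integral_congr fun θ _ => ?_
    have e1 := congrArg (fun x => inner ℝ (V t θ - e θ) x) (heq t ht θ)
    simp only [inner_add_right, inner_smul_right, inner_zero_right] at e1
    simp only [Pi.pow_apply, real_inner_self_eq_norm_sq, inner_add_right, inner_smul_right, Nat.cast_ofNat,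
      Nat.add_one_sub_one, pow_one]
    linear_combination (2 * φ t) * e1
  all_goals exact Continuous.intervalIntegrable (by fun_prop) _ _

end HalfCylinderC2

lemma tendsto_integral_closedHalfCylinder {p : ℝ → ℝ → ℝ}
    (hp : ContinuousOn (Function.uncurry p) (Iic 0 ×ˢ univ)) (a b : ℝ) :
    Tendsto (fun t => ∫ θ in a..b, p t θ) (𝓝[<] 0) (𝓝 (∫ θ in a..b, p 0 θ)) := by
  have hc : Continuous (Function.uncurry fun t θ => p (min t 0) θ) := by
    have : Continuous fun x : ℝ × ℝ => Function.uncurry p (min x.1 0, x.2) :=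
      hp.comp_continuous (by fun_prop) (fun x => ⟨min_le_right x.1 0, mem_univ _⟩)
    exact this
  have h := (intervalIntegral.continuous_parametric_intervalIntegral_of_continuous' (μ := volume)
    hc a b).tendsto 0
  simp only [min_self] at h
  refine (h.mono_left nhdsWithin_le_nhds).congr' ?_
  filter_upwards [self_mem_nhdsWithin] with t ht
  rw [min_eq_left (le_of_lt ht)]

namespace HalfCylinderC2

variable {E : Type*} [NormedAddCommGroup E] [InnerProductSpace ℝ E]
  {V Vt Vθ Vtt Vtθ Vθθ : ℝ → ℝ → E}

/-- The Pohozaev-type quantity is nonnegative, because of the boundary condition `V = e`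
at `t = 0`. -/
lemma pohozaev_nonneg (hV : HalfCylinderC2 V Vt Vθ Vtt Vtθ Vθθ)
    {φ φ' c c' : ℝ → ℝ} {n : E → E} {k : E → ℝ} (hn : Continuous n) (hk : Continuous k)
    (hkd : ∀ (γ : ℝ → E) (γ' : E) (t : ℝ), HasDerivAt γ γ' t →
      HasDerivAt (fun s => k (γ s)) (-inner ℝ (n (γ t)) γ') t)
    (hk0 : ∀ x, 0 ≤ k x)
    (hφ : ∀ t < 0, 0 < φ t) (hφd : ∀ t < 0, HasDerivAt φ (φ' t) t) (hφ' : ∀ t < 0, 0 < φ' t)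
    (hc : ∀ t < 0, HasDerivAt c (c' t) t) (hc' : ContinuousOn c' (Iio 0))
    (hc'pos : ∀ t < 0, 0 ≤ c' t) (hccl : ContinuousOn c (Iic 0))
    (heq : ∀ t < 0, ∀ θ, φ t • (Vtt t θ + Vθθ t θ + V t θ + c t • n (V t θ))
      + (2 * φ' t) • Vt t θ = 0)
    {e e' : ℝ → E} (he : ∀ θ, HasDerivAt e (e' θ) θ) (he' : ∀ θ, HasDerivAt e' (-e θ) θ)
    (pe : e (2 * Real.pi) = e 0) (pe' : e' (2 * Real.pi) = e' 0)
    (hVcl : ContinuousOn (Function.uncurry V) (Iic 0 ×ˢ univ)) (hV0 : ∀ θ, V 0 θ = e θ)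
    (hke : ∀ θ, k (e θ) = 0) {t₁ : ℝ} (ht₁ : t₁ < 0) :
    0 ≤ ∫ θ in (0 : ℝ)..2 * Real.pi,
      (‖Vt t₁ θ‖ ^ 2 / 2 - ‖Vθ t₁ θ‖ ^ 2 / 2 + ‖V t₁ θ‖ ^ 2 / 2 - c t₁ * k (V t₁ θ)) := by
  by_contra hneg
  push Not at hneg
  have hpi : (0 : ℝ) ≤ 2 * Real.pi := by positivity
  have ce : Continuous e := continuous_iff_continuousAt.2 fun θ => (he θ).continuousAt
  set F : ℝ → ℝ := fun t => ∫ θ in (0 : ℝ)..2 * Real.pi,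
      (‖Vt t θ‖ ^ 2 / 2 - ‖Vθ t θ‖ ^ 2 / 2 + ‖V t θ‖ ^ 2 / 2 - c t * k (V t θ)) with hF
  have hFd := fun t ht => hV.hasDerivAt_pohozaev hn hk hkd hφ hc hc' heq (t := t) ht
  have hFanti : AntitoneOn F (Iio 0) := by
    refine antitoneOn_of_deriv_nonpos (convex_Iio _)
      (fun t ht => (hFd t ht).continuousAt.continuousWithinAt)
      (fun t ht => (hFd t (by simpa using ht)).differentiableAt.differentiableWithinAt) ?_
    intro t ht
    replace ht : t < 0 := by simpa using ht
    rw [(hFd t ht).deriv]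
    refine neg_nonpos.2 (intervalIntegral.integral_nonneg hpi fun θ _ => ?_)
    have := hφ t ht
    have := hφ' t ht
    have := hc'pos t ht
    have := hk0 (V t θ)
    positivity
  have dV := hVcl
  simp only [Function.uncurry_def] at dV
  have dc : ContinuousOn (fun p : ℝ × ℝ => c p.1) (Iic 0 ×ˢ univ) :=
    hccl.comp continuousOn_fst (fun p hp => hp.1)
  have de : ContinuousOn (fun p : ℝ × ℝ => e p.2) (Iic 0 ×ˢ univ) :=
    (ce.comp continuous_snd).continuousOn
  have hlim : Tendsto (fun t => ∫ θ in (0 : ℝ)..2 * Real.pi, ‖V t θ - e θ‖ ^ 2)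
      (𝓝[<] 0) (𝓝 0) := by
    have h := tendsto_integral_closedHalfCylinder (p := fun t θ => ‖V t θ - e θ‖ ^ 2)
      (by simp only [Function.uncurry_def]; exact (dV.sub de).norm.pow 2) 0 (2 * Real.pi)
    simpa [hV0] using h
  have hrem : Tendsto (fun t => ∫ θ in (0 : ℝ)..2 * Real.pi,
      c t * (2 * k (V t θ) + inner ℝ (V t θ - e θ) (n (V t θ)))) (𝓝[<] 0) (𝓝 0) := by
    have h := tendsto_integral_closedHalfCylinder
      (p := fun t θ => c t * (2 * k (V t θ) + inner ℝ (V t θ - e θ) (n (V t θ))))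
      (dc.mul ((continuousOn_const.mul (hk.comp_continuousOn dV)).add
        ((dV.sub de).inner (hn.comp_continuousOn dV)))) 0 (2 * Real.pi)
    simpa [hV0, hke] using h
  obtain ⟨t₂, ht₂, hsub⟩ : ∃ t₂ < (0 : ℝ), Ico t₂ 0 ⊆ {t | (∫ θ in (0 : ℝ)..2 * Real.pi,
      c t * (2 * k (V t θ) + inner ℝ (V t θ - e θ) (n (V t θ)))) < -2 * F t₁} := by
    have hev := hrem.eventually (gt_mem_nhds (show (0 : ℝ) < -2 * F t₁ by linarith))
    obtain ⟨l, hl, hl'⟩ := (mem_nhdsLT_iff_exists_Ico_subset (a := (0 : ℝ))).1 hev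
    exact ⟨l, hl, hl'⟩
  set t₀ := max t₁ t₂ with ht₀
  have ht₀neg : t₀ < 0 := max_lt ht₁ ht₂
  -- the forcing term in the equation for the distance to the boundary datum
  have hgap : ∀ t ∈ Ico t₀ 0, (∫ θ in (0 : ℝ)..2 * Real.pi, ‖Vt t θ‖ ^ 2)
      < -∫ θ in (0 : ℝ)..2 * Real.pi,
        inner ℝ (V t θ - e θ) (Vθθ t θ + V t θ + c t • n (V t θ)) := by
    intro t ht
    have htn := ht.2
    have h1 : F t ≤ F t₁ := hFanti ht₁ htn ((le_max_left _ _).trans ht.1)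
    have h2 : (∫ θ in (0 : ℝ)..2 * Real.pi,
      c t * (2 * k (V t θ) + inner ℝ (V t θ - e θ) (n (V t θ)))) < -2 * F t₁ :=
      hsub ⟨(le_max_right _ _).trans ht.1, htn⟩
    have c1 := continuous_slice hV.cV htn
    have c2 := continuous_slice hV.cVt htn
    have c3 := continuous_slice hV.cVθ htn
    have c6 := continuous_slice hV.cVθθ htn
    have h3 : (∫ θ in (0 : ℝ)..2 * Real.pi,
        inner ℝ (V t θ - e θ) (Vθθ t θ + V t θ + c t • n (V t θ)))
        = (∫ θ in (0 : ℝ)..2 * Real.pi, inner ℝ (V t θ - e θ) (Vθθ t θ + V t θ))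
          + ∫ θ in (0 : ℝ)..2 * Real.pi, c t * inner ℝ (V t θ - e θ) (n (V t θ)) := by
      rw [← intervalIntegral.integral_add]
      · refine intervalIntegral.integral_congr fun θ _ => ?_
        simp only [inner_add_right, inner_smul_right]
      all_goals exact Continuous.intervalIntegrable (by fun_prop) _ _
    rw [hV.integral_inner_sub_Vθθ he he' pe pe' htn] at h3
    have h4 : 2 * F t = (∫ θ in (0 : ℝ)..2 * Real.pi, ‖Vt t θ‖ ^ 2)
        - (∫ θ in (0 : ℝ)..2 * Real.pi, (‖Vθ t θ‖ ^ 2 - ‖V t θ‖ ^ 2))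
        - ((∫ θ in (0 : ℝ)..2 * Real.pi,
            c t * (2 * k (V t θ) + inner ℝ (V t θ - e θ) (n (V t θ))))
          - ∫ θ in (0 : ℝ)..2 * Real.pi, c t * inner ℝ (V t θ - e θ) (n (V t θ))) := by
      rw [hF, ← intervalIntegral.integral_sub, ← intervalIntegral.integral_sub,
        ← intervalIntegral.integral_sub, ← intervalIntegral.integral_const_mul]
      · refine intervalIntegral.integral_congr fun θ _ => ?_
        ring
      all_goals exact Continuous.intervalIntegrable (by fun_prop) _ _
    linarith
  refine not_tendsto_zero_of_weighted_log_convex (ρ := fun t => φ t ^ 2) (ρ₀ := φ t₀ ^ 2)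
    ht₀neg (pow_pos (hφ t₀ ht₀neg) 2) ?_ ?_
    (fun t ht => hV.hasDerivAt_integral_dist_sq ce ht.2)
    (fun t ht => hV.hasDerivAt_weighted_integral_inner hn ce hφd heq ht.2) ?_ hlim
  · have hmono : MonotoneOn φ (Iio 0) := by
      refine monotoneOn_of_deriv_nonneg (convex_Iio _)
        (fun t ht => (hφd t ht).continuousAt.continuousWithinAt)
        (fun t ht => (hφd t (by simpa using ht)).differentiableAt.differentiableWithinAt) ?_
      intro t ht
      replace ht : t < 0 := by simpa using ht
      rw [(hφd t ht).deriv]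
      exact (hφ' t ht).le
    intro t ht
    exact pow_le_pow_left₀ (hφ t₀ ht₀neg).le (hmono ht₀neg ht.2 ht.1) 2
  · intro t ht
    have c1 := continuous_slice hV.cV ht.2
    have c6 := continuous_slice hV.cVθθ ht.2
    have cs := sq_integral_inner_le (x := fun θ => V t θ - e θ)
      (y := fun θ => Vθθ t θ + V t θ + c t • n (V t θ)) (by fun_prop) (by fun_prop) hpi
    have hnn : 0 ≤ ∫ θ in (0 : ℝ)..2 * Real.pi, ‖V t θ - e θ‖ ^ 2 :=
      intervalIntegral.integral_nonneg hpi fun θ _ => by positivity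
    have hA : 0 ≤ ∫ θ in (0 : ℝ)..2 * Real.pi, ‖Vt t θ‖ ^ 2 :=
      intervalIntegral.integral_nonneg hpi fun θ _ => by positivity
    refine lt_of_le_of_ne hnn fun h0 => ?_
    rw [← h0, zero_mul] at cs
    have := hgap t ht
    rw [pow_eq_zero_iff two_ne_zero |>.1 (le_antisymm cs (sq_nonneg _))] at this
    linarith
  · intro t ht
    have c1 := continuous_slice hV.cV ht.2
    have c2 := continuous_slice hV.cVt ht.2
    have cs := sq_integral_inner_le (x := fun θ => V t θ - e θ)
      (y := fun θ => Vt t θ) (by fun_prop) (by fun_prop) hpi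
    have hnn : 0 ≤ ∫ θ in (0 : ℝ)..2 * Real.pi, ‖V t θ - e θ‖ ^ 2 :=
      intervalIntegral.integral_nonneg hpi fun θ _ => by positivity
    have hg := hgap t ht
    rw [intervalIntegral.integral_const_mul]
    have hφ2 := pow_pos (hφ t ht.2) 2
    set I := ∫ θ in (0 : ℝ)..2 * Real.pi, inner ℝ (V t θ - e θ) (Vt t θ)
    set H := ∫ θ in (0 : ℝ)..2 * Real.pi, ‖V t θ - e θ‖ ^ 2
    set A := ∫ θ in (0 : ℝ)..2 * Real.pi, ‖Vt t θ‖ ^ 2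
    set Z := ∫ θ in (0 : ℝ)..2 * Real.pi,
        inner ℝ (V t θ - e θ) (Vθθ t θ + V t θ + c t • n (V t θ))
    have h1 : (2 * I) ^ 2 ≤ 2 * (A - Z) * H := by nlinarith
    calc φ t ^ 2 * (2 * I) ^ 2 ≤ φ t ^ 2 * (2 * (A - Z) * H) := by gcongr
      _ = 2 * φ t ^ 2 * (A - Z) * H := by ring

/-- Uniqueness for `φ (ΔV + V + c n(V)) + 2 φ' ∂ₜV = 0` on the half-cylinder `t < 0`, under
boundary conditions at `t = 0` and as `t → -∞`. -/
lemma eq_boundary_datum (hV : HalfCylinderC2 V Vt Vθ Vtt Vtθ Vθθ)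
    {φ φ' c c' : ℝ → ℝ} {n : E → E} {k : E → ℝ} (hn : Continuous n) (hk : Continuous k)
    (hkd : ∀ (γ : ℝ → E) (γ' : E) (t : ℝ), HasDerivAt γ γ' t →
      HasDerivAt (fun s => k (γ s)) (-inner ℝ (n (γ t)) γ') t)
    (hk0 : ∀ x, 0 ≤ k x)
    (hφ : ∀ t < 0, 0 < φ t) (hφd : ∀ t < 0, HasDerivAt φ (φ' t) t) (hφ' : ∀ t < 0, 0 < φ' t)
    (hcpos : ∀ t < 0, 0 ≤ c t)
    (hc : ∀ t < 0, HasDerivAt c (c' t) t) (hc' : ContinuousOn c' (Iio 0))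
    (hc'pos : ∀ t < 0, 0 ≤ c' t) (hccl : ContinuousOn c (Iic 0))
    (heq : ∀ t < 0, ∀ θ, φ t • (Vtt t θ + Vθθ t θ + V t θ + c t • n (V t θ))
      + (2 * φ' t) • Vt t θ = 0)
    {e e' : ℝ → E} (he : ∀ θ, HasDerivAt e (e' θ) θ) (he' : ∀ θ, HasDerivAt e' (-e θ) θ)
    (pe : e (2 * Real.pi) = e 0) (pe' : e' (2 * Real.pi) = e' 0)
    (hVcl : ContinuousOn (Function.uncurry V) (Iic 0 ×ˢ univ)) (hV0 : ∀ θ, V 0 θ = e θ)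
    (hke : ∀ θ, k (e θ) = 0)
    (hbot : Tendsto (fun t => ∫ θ in (0 : ℝ)..2 * Real.pi,
      (‖Vt t θ‖ ^ 2 - ‖Vθ t θ‖ ^ 2 + ‖V t θ‖ ^ 2)) atBot (𝓝 0))
    {t θ : ℝ} (ht : t < 0) (hθ : θ ∈ Icc 0 (2 * Real.pi)) : V t θ = e θ := by
  have hpi : (0 : ℝ) < 2 * Real.pi := by positivity
  set F : ℝ → ℝ := fun t => ∫ θ in (0 : ℝ)..2 * Real.pi,
      (‖Vt t θ‖ ^ 2 / 2 - ‖Vθ t θ‖ ^ 2 / 2 + ‖V t θ‖ ^ 2 / 2 - c t * k (V t θ)) with hF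
  have hFd := fun t ht => hV.hasDerivAt_pohozaev hn hk hkd hφ hc hc' heq (t := t) ht
  have hnn : ∀ t < 0, ∀ θ, 0 ≤ 2 * (φ' t / φ t) * ‖Vt t θ‖ ^ 2 + c' t * k (V t θ) := by
    intro t ht θ
    have := hφ t ht
    have := hφ' t ht
    have := hc'pos t ht
    have := hk0 (V t θ)
    positivity
  have hFanti : AntitoneOn F (Iio 0) := by
    refine antitoneOn_of_deriv_nonpos (convex_Iio _)
      (fun t ht => (hFd t ht).continuousAt.continuousWithinAt)
      (fun t ht => (hFd t (by simpa using ht)).differentiableAt.differentiableWithinAt) ?_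
    intro t ht
    replace ht : t < 0 := by simpa using ht
    rw [(hFd t ht).deriv]
    exact neg_nonpos.2 (intervalIntegral.integral_nonneg hpi.le fun θ _ => hnn t ht θ)
  have hFle : ∀ t < 0, F t ≤ 0 := by
    intro t ht
    have h2 : Tendsto (fun t => (∫ θ in (0 : ℝ)..2 * Real.pi,
      (‖Vt t θ‖ ^ 2 - ‖Vθ t θ‖ ^ 2 + ‖V t θ‖ ^ 2)) / 2) atBot (𝓝 0) := by
      simpa using hbot.div_const 2
    refine ge_of_tendsto h2 ?_
    filter_upwards [Iic_mem_atBot t] with s hs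
    have hs0 : s < 0 := lt_of_le_of_lt hs ht
    refine (hFanti hs0 ht hs).trans ?_
    have c1 := continuous_slice hV.cV hs0
    have c2 := continuous_slice hV.cVt hs0
    have c3 := continuous_slice hV.cVθ hs0
    rw [hF, ← intervalIntegral.integral_div]
    refine intervalIntegral.integral_mono_on hpi.le
      (Continuous.intervalIntegrable (by fun_prop) _ _)
      (Continuous.intervalIntegrable (by fun_prop) _ _) fun θ _ => ?_
    have := mul_nonneg (hcpos s hs0) (hk0 (V s θ))
    linarith
  have hF0 : ∀ t < 0, F t = 0 := fun t ht => le_antisymm (hFle t ht)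
    (hV.pohozaev_nonneg hn hk hkd hk0 hφ hφd hφ' hc hc' hc'pos hccl heq he he' pe pe' hVcl
      hV0 hke ht)
  have hVt : ∀ t < 0, ∀ θ ∈ Icc 0 (2 * Real.pi), Vt t θ = 0 := by
    intro t ht θ hθ
    have h1 : HasDerivAt F 0 t := by
      refine (hasDerivAt_const t (0 : ℝ)).congr_of_eventuallyEq ?_
      filter_upwards [Iio_mem_nhds ht] with s hs using hF0 s hs
    have h2 := (hFd t ht).unique h1
    rw [neg_eq_zero] at h2
    have c1 := continuous_slice hV.cV ht
    have c2 := continuous_slice hV.cVt ht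
    have h4 : (2 * (φ' t / φ t) * ‖Vt t θ‖ ^ 2 + c' t * k (V t θ)) = 0 := by
      by_contra hne
      have := intervalIntegral.integral_pos (a := 0) (b := 2 * Real.pi)
        (f := fun θ => 2 * (φ' t / φ t) * ‖Vt t θ‖ ^ 2 + c' t * k (V t θ)) hpi
        (Continuous.continuousOn (by fun_prop)) (fun x _ => hnn t ht x)
        ⟨θ, hθ, lt_of_le_of_ne (hnn t ht θ) (Ne.symm hne)⟩
      linarith
    have hm : 0 < 2 * (φ' t / φ t) := by
      have := hφ t ht
      have := hφ' t ht
      positivity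
    have h5 := mul_nonneg (hc'pos t ht) (hk0 (V t θ))
    have h6 : ‖Vt t θ‖ ^ 2 = 0 := by
      by_contra hne
      have : 0 < ‖Vt t θ‖ ^ 2 := lt_of_le_of_ne (sq_nonneg _) (Ne.symm hne)
      have := mul_pos hm this
      linarith
    simpa using h6
  have hcont : ContinuousOn (fun s => V s θ) (Icc t 0) := by
    have : ContinuousOn (fun s : ℝ => Function.uncurry V (s, θ)) (Icc t 0) :=
      hVcl.comp (by fun_prop) (fun s hs => ⟨hs.2, mem_univ _⟩)
    exact this
  have := constant_of_has_deriv_right_zero hcont (fun s hs => by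
    have := hV.dt s hs.2 θ
    rw [hVt s hs.2 θ hθ] at this
    exact this.hasDerivWithinAt) 0 ⟨ht.le, le_rfl⟩
  rw [← this, hV0]

end HalfCylinderC2

namespace HalfCylinderC2

lemma smul {E : Type*} [NormedAddCommGroup E] [NormedSpace ℝ E]
    {V Vt Vθ Vtt Vtθ Vθθ : ℝ → ℝ → E} (hV : HalfCylinderC2 V Vt Vθ Vtt Vtθ Vθθ)
    {g g' g'' : ℝ → ℝ} (hg : ∀ t < 0, HasDerivAt g (g' t) t)
    (hg' : ∀ t < 0, HasDerivAt g' (g'' t) t) (cg'' : ContinuousOn g'' (Iio 0)) :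
    HalfCylinderC2 (fun t θ => g t • V t θ) (fun t θ => g t • Vt t θ + g' t • V t θ)
      (fun t θ => g t • Vθ t θ)
      (fun t θ => g t • Vtt t θ + g' t • Vt t θ + (g' t • Vt t θ + g'' t • V t θ))
      (fun t θ => g t • Vtθ t θ + g' t • Vθ t θ) (fun t θ => g t • Vθθ t θ) := by
  have hfst : MapsTo (Prod.fst : ℝ × ℝ → ℝ) (Iio 0 ×ˢ univ) (Iio 0) := fun p hp => hp.1
  have c0 : ContinuousOn (fun p : ℝ × ℝ => g p.1) (Iio 0 ×ˢ univ) :=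
    ContinuousOn.comp (fun s hs => (hg s hs).continuousAt.continuousWithinAt)
      continuousOn_fst hfst
  have c1 : ContinuousOn (fun p : ℝ × ℝ => g' p.1) (Iio 0 ×ˢ univ) :=
    ContinuousOn.comp (fun s hs => (hg' s hs).continuousAt.continuousWithinAt)
      continuousOn_fst hfst
  have c2 : ContinuousOn (fun p : ℝ × ℝ => g'' p.1) (Iio 0 ×ˢ univ) :=
    cg''.comp continuousOn_fst hfst
  constructor
  · exact c0.smul hV.cV
  · exact (c0.smul hV.cVt).add (c1.smul hV.cV)
  · exact c0.smul hV.cVθ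
  · exact ((c0.smul hV.cVtt).add (c1.smul hV.cVt)).add ((c1.smul hV.cVt).add (c2.smul hV.cV))
  · exact (c0.smul hV.cVtθ).add (c1.smul hV.cVθ)
  · exact c0.smul hV.cVθθ
  · exact fun t ht θ => (hg t ht).smul (hV.dt t ht θ)
  · exact fun t ht θ => (hV.dθ t ht θ).const_smul _
  · exact fun t ht θ => ((hg t ht).smul (hV.dtt t ht θ)).add ((hg' t ht).smul (hV.dt t ht θ))
  · exact fun t ht θ => (hg t ht).smul (hV.dtθ t ht θ)
  · exact fun t ht θ => ((hV.dθt t ht θ).const_smul _).add ((hV.dθ t ht θ).const_smul _)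
  · exact fun t ht θ => (hV.dθθ t ht θ).const_smul _
  · intro t ht; simp only [hV.pV t ht]
  · intro t ht; simp only [hV.pV t ht, hV.pVt t ht]
  · intro t ht; simp only [hV.pVθ t ht]

lemma _root_.HasDerivAt.toLp_prod {a b : ℝ → ℂ} {a' b' : ℂ} {t : ℝ} (ha : HasDerivAt a a' t)
    (hb : HasDerivAt b b' t) :
    HasDerivAt (fun s => WithLp.toLp 2 (a s, b s)) (WithLp.toLp 2 (a', b')) t :=
  (WithLp.prodContinuousLinearEquiv 2 ℝ ℂ ℂ).symm.hasFDerivAt.comp_hasDerivAt t (ha.prodMk hb)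

lemma _root_.ContinuousOn.toLp_prod {X : Type*} [TopologicalSpace X] {a b : X → ℂ} {s : Set X}
    (ha : ContinuousOn a s) (hb : ContinuousOn b s) :
    ContinuousOn (fun x => WithLp.toLp 2 (a x, b x)) s :=
  (WithLp.prodContinuousLinearEquiv 2 ℝ ℂ ℂ).symm.continuous.comp_continuousOn (ha.prodMk hb)

lemma toLp_prod {V Vt Vθ Vtt Vtθ Vθθ W Wt Wθ Wtt Wtθ Wθθ : ℝ → ℝ → ℂ}
    (hV : HalfCylinderC2 V Vt Vθ Vtt Vtθ Vθθ) (hW : HalfCylinderC2 W Wt Wθ Wtt Wtθ Wθθ) :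
    HalfCylinderC2 (fun t θ => WithLp.toLp 2 (V t θ, W t θ))
      (fun t θ => WithLp.toLp 2 (Vt t θ, Wt t θ)) (fun t θ => WithLp.toLp 2 (Vθ t θ, Wθ t θ))
      (fun t θ => WithLp.toLp 2 (Vtt t θ, Wtt t θ)) (fun t θ => WithLp.toLp 2 (Vtθ t θ, Wtθ t θ))
      (fun t θ => WithLp.toLp 2 (Vθθ t θ, Wθθ t θ)) where
  cV := hV.cV.toLp_prod hW.cV
  cVt := hV.cVt.toLp_prod hW.cVt
  cVθ := hV.cVθ.toLp_prod hW.cVθ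
  cVtt := hV.cVtt.toLp_prod hW.cVtt
  cVtθ := hV.cVtθ.toLp_prod hW.cVtθ
  cVθθ := hV.cVθθ.toLp_prod hW.cVθθ
  dt t ht θ := (hV.dt t ht θ).toLp_prod (hW.dt t ht θ)
  dθ t ht θ := (hV.dθ t ht θ).toLp_prod (hW.dθ t ht θ)
  dtt t ht θ := (hV.dtt t ht θ).toLp_prod (hW.dtt t ht θ)
  dtθ t ht θ := (hV.dtθ t ht θ).toLp_prod (hW.dtθ t ht θ)
  dθt t ht θ := (hV.dθt t ht θ).toLp_prod (hW.dθt t ht θ)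
  dθθ t ht θ := (hV.dθθ t ht θ).toLp_prod (hW.dθθ t ht θ)
  pV t ht := by simp only [hV.pV t ht, hW.pV t ht]
  pVt t ht := by simp only [hV.pVt t ht, hW.pVt t ht]
  pVθ t ht := by simp only [hV.pVθ t ht, hW.pVθ t ht]

end HalfCylinderC2

/-- The point with logarithmic polar coordinates `(t, θ)`, i.e. with modulus `exp t` and
argument `θ`. -/
def logPolar (t θ : ℝ) : ℂ := Complex.exp (t + θ * Complex.I)

lemma norm_logPolar (t θ : ℝ) : ‖logPolar t θ‖ = Real.exp t := by
  simp [logPolar, Complex.norm_exp]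

lemma logPolar_mem_ball {t : ℝ} (ht : t < 0) (θ : ℝ) : logPolar t θ ∈ ball (0 : ℂ) 1 := by
  simp [norm_logPolar, ht]

lemma continuous_logPolar : Continuous (Function.uncurry logPolar) := by
  simp only [logPolar, Function.uncurry_def]
  fun_prop

lemma logPolar_eq (t θ : ℝ) : logPolar t θ = Real.exp t * Complex.exp (θ * Complex.I) := by
  simp [logPolar, Complex.exp_add]

lemma hasDerivAt_logPolar_fst (t θ : ℝ) :
    HasDerivAt (fun s => logPolar s θ) (logPolar t θ) t := by
  have h : HasDerivAt (fun s : ℝ => (s : ℂ) + θ * Complex.I) 1 t :=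
    (Complex.ofRealCLM.hasDerivAt).add_const _
  simpa [logPolar] using h.cexp

lemma hasDerivAt_logPolar_snd (t θ : ℝ) :
    HasDerivAt (logPolar t) (Complex.I * logPolar t θ) θ := by
  have h : HasDerivAt (fun s : ℝ => (t : ℂ) + s * Complex.I) Complex.I θ := by
    have := ((Complex.ofRealCLM.hasDerivAt (x := θ)).mul_const Complex.I).const_add (t : ℂ)
    simpa using this
  exact h.cexp.congr_deriv (mul_comm _ _)

lemma logPolar_two_pi (t : ℝ) : logPolar t (2 * Real.pi) = logPolar t 0 := by
  simp [logPolar, Complex.exp_add, Complex.exp_two_pi_mul_I]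

lemma halfCylinderC2_comp_logPolar {ψ : ℂ → ℂ} (hψ : ContDiffOn ℝ 2 ψ (ball 0 1)) :
    HalfCylinderC2 (fun t θ => ψ (logPolar t θ))
      (fun t θ => fderiv ℝ ψ (logPolar t θ) (logPolar t θ))
      (fun t θ => fderiv ℝ ψ (logPolar t θ) (Complex.I * logPolar t θ))
      (fun t θ => fderiv ℝ (fderiv ℝ ψ) (logPolar t θ) (logPolar t θ) (logPolar t θ)
        + fderiv ℝ ψ (logPolar t θ) (logPolar t θ))
      (fun t θ => fderiv ℝ (fderiv ℝ ψ) (logPolar t θ) (logPolar t θ) (Complex.I * logPolar t θ)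
        + fderiv ℝ ψ (logPolar t θ) (Complex.I * logPolar t θ))
      (fun t θ => fderiv ℝ (fderiv ℝ ψ) (logPolar t θ) (Complex.I * logPolar t θ)
          (Complex.I * logPolar t θ)
        + fderiv ℝ ψ (logPolar t θ) (Complex.I * (Complex.I * logPolar t θ))) := by
  have hmaps : MapsTo (Function.uncurry logPolar) (Iio 0 ×ˢ univ) (ball 0 1) :=
    fun p hp => logPolar_mem_ball hp.1 p.2
  have cz : ContinuousOn (Function.uncurry logPolar) (Iio 0 ×ˢ univ) :=
    continuous_logPolar.continuousOn
  have cIz : ContinuousOn (fun p : ℝ × ℝ => Complex.I * Function.uncurry logPolar p)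
      (Iio 0 ×ˢ univ) := continuousOn_const.mul cz
  have hD : ContDiffOn ℝ 1 (fderiv ℝ ψ) (ball 0 1) := hψ.fderiv_of_isOpen isOpen_ball (by norm_num)
  have hD2 : ContDiffOn ℝ 0 (fderiv ℝ (fderiv ℝ ψ)) (ball 0 1) :=
    hD.fderiv_of_isOpen isOpen_ball (by norm_num)
  have cD := hD.continuousOn.comp cz hmaps
  have cD2 := hD2.continuousOn.comp cz hmaps
  have dψ : ∀ z ∈ ball (0 : ℂ) 1, HasFDerivAt ψ (fderiv ℝ ψ z) z := fun z hz =>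
    ((hψ.differentiableOn (by norm_num)).differentiableAt (isOpen_ball.mem_nhds hz)).hasFDerivAt
  have dD : ∀ z ∈ ball (0 : ℂ) 1, HasFDerivAt (fderiv ℝ ψ) (fderiv ℝ (fderiv ℝ ψ) z) z :=
    fun z hz =>
    ((hD.differentiableOn (by norm_num)).differentiableAt (isOpen_ball.mem_nhds hz)).hasFDerivAt
  have dDt : ∀ t < 0, ∀ θ, HasDerivAt (fun s => fderiv ℝ ψ (logPolar s θ))
      (fderiv ℝ (fderiv ℝ ψ) (logPolar t θ) (logPolar t θ)) t := fun t ht θ =>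
    (dD _ (logPolar_mem_ball ht θ)).comp_hasDerivAt t (hasDerivAt_logPolar_fst t θ)
  have dDθ : ∀ t < 0, ∀ θ, HasDerivAt (fun s => fderiv ℝ ψ (logPolar t s))
      (fderiv ℝ (fderiv ℝ ψ) (logPolar t θ) (Complex.I * logPolar t θ)) θ := fun t ht θ =>
    (dD _ (logPolar_mem_ball ht θ)).comp_hasDerivAt θ (hasDerivAt_logPolar_snd t θ)
  constructor
  · exact hψ.continuousOn.comp cz hmaps
  · exact cD.clm_apply cz
  · exact cD.clm_apply cIz
  · exact ((cD2.clm_apply cz).clm_apply cz).add (cD.clm_apply cz)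
  · exact ((cD2.clm_apply cz).clm_apply cIz).add (cD.clm_apply cIz)
  · exact ((cD2.clm_apply cIz).clm_apply cIz).add (cD.clm_apply (continuousOn_const.mul cIz))
  · exact fun t ht θ => (dψ _ (logPolar_mem_ball ht θ)).comp_hasDerivAt t
      (hasDerivAt_logPolar_fst t θ)
  · exact fun t ht θ => (dψ _ (logPolar_mem_ball ht θ)).comp_hasDerivAt θ
      (hasDerivAt_logPolar_snd t θ)
  · exact fun t ht θ => (dDt t ht θ).clm_apply (hasDerivAt_logPolar_fst t θ)
  · exact fun t ht θ => (dDt t ht θ).clm_apply ((hasDerivAt_logPolar_fst t θ).const_mul _)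
  · intro t ht θ
    refine ((dDθ t ht θ).clm_apply (hasDerivAt_logPolar_snd t θ)).congr_deriv ?_
    have hz := logPolar_mem_ball ht θ
    have hsymm := ((hψ.contDiffAt (isOpen_ball.mem_nhds hz)).isSymmSndFDerivAt (by simp))
    rw [hsymm.eq]
  · exact fun t ht θ => (dDθ t ht θ).clm_apply ((hasDerivAt_logPolar_snd t θ).const_mul _)
  all_goals
    intro t ht
    simp only [logPolar_two_pi]

lemma lap_eq {ψ : ℂ → ℂ} (hψ : ContDiffOn ℝ 2 ψ (ball 0 1)) {z : ℂ} (hz : z ∈ ball (0 : ℂ) 1) :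
    lap ψ z = fderiv ℝ (fderiv ℝ ψ) z 1 1 + fderiv ℝ (fderiv ℝ ψ) z Complex.I Complex.I := by
  have hD : ContDiffOn ℝ 1 (fderiv ℝ ψ) (ball 0 1) := hψ.fderiv_of_isOpen isOpen_ball (by norm_num)
  have dD : DifferentiableAt ℝ (fderiv ℝ ψ) z :=
    (hD.differentiableOn (by norm_num)).differentiableAt (isOpen_ball.mem_nhds hz)
  have h : ∀ w : ℂ, fderiv ℝ (fun y => fderiv ℝ ψ y w) z w = fderiv ℝ (fderiv ℝ ψ) z w w := by
    intro w
    rw [fderiv_clm_apply dD (differentiableAt_const w)]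
    simp
  rw [lap, h, h]

/-- The Laplacian in logarithmic polar coordinates. -/
lemma logPolar_laplacian {ψ : ℂ → ℂ} (hψ : ContDiffOn ℝ 2 ψ (ball 0 1)) {t : ℝ} (ht : t < 0)
    (θ : ℝ) :
    (fderiv ℝ (fderiv ℝ ψ) (logPolar t θ) (logPolar t θ) (logPolar t θ)
        + fderiv ℝ ψ (logPolar t θ) (logPolar t θ))
      + (fderiv ℝ (fderiv ℝ ψ) (logPolar t θ) (Complex.I * logPolar t θ)
          (Complex.I * logPolar t θ)
        + fderiv ℝ ψ (logPolar t θ) (Complex.I * (Complex.I * logPolar t θ)))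
      = ((Real.exp t ^ 2 : ℝ) : ℂ) * lap ψ (logPolar t θ) := by
  rw [lap_eq hψ (logPolar_mem_ball ht θ), ← norm_logPolar t θ]
  set z := logPolar t θ
  have h1 : z = z.re • (1 : ℂ) + z.im • Complex.I := by
    simp [Complex.re_add_im]
  have h2 : Complex.I * z = (-z.im) • (1 : ℂ) + z.re • Complex.I := by
    apply Complex.ext <;> simp
  have h3 : Complex.I * (Complex.I * z) = -z := by
    rw [← mul_assoc, Complex.I_mul_I]; ring
  have h4 : ‖z‖ ^ 2 = z.re ^ 2 + z.im ^ 2 := by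
    rw [Complex.sq_norm, Complex.normSq_apply]; ring
  rw [h3, map_neg, h4, h2]
  generalize fderiv ℝ (fderiv ℝ ψ) z = B
  generalize fderiv ℝ ψ z = L
  have h5 : B z z = (z.re • B 1 + z.im • B Complex.I) (z.re • (1 : ℂ) + z.im • Complex.I) := by
    rw [← map_smul, ← map_smul, ← map_add, ← h1]
  rw [h5]
  simp only [map_add, map_smul, add_apply, smul_apply]
  simp only [Complex.real_smul]
  push_cast
  ring

lemma tendsto_exp_neg_mul_comp_logPolar {ψ : ℂ → ℂ} {L : ℂ →L[ℝ] ℂ} (hψ : HasFDerivAt ψ L 0)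
    (h0 : ψ 0 = 0) (θ : ℝ) :
    Tendsto (fun t => Real.exp (-t) • ψ (logPolar t θ)) atBot
      (𝓝 (L (Complex.exp (θ * Complex.I)))) := by
  set w := Complex.exp (θ * Complex.I) with hw
  have h1 : HasDerivAt (fun s : ℝ => ψ (s • w)) (L w) 0 := by
    have h2 : HasDerivAt (fun s : ℝ => s • w) w 0 := by
      simpa using (hasDerivAt_id (0 : ℝ)).smul_const w
    have h3 : HasFDerivAt ψ L ((0 : ℝ) • w) := by simpa using hψ
    exact h3.comp_hasDerivAt (0 : ℝ) h2
  have h4 := hasDerivAt_iff_tendsto_slope_zero.1 h1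
  have h5 : Tendsto Real.exp atBot (𝓝[≠] 0) :=
    tendsto_nhdsWithin_iff.2 ⟨Real.tendsto_exp_atBot,
      Eventually.of_forall fun t => (Real.exp_pos t).ne'⟩
  refine (h4.comp h5).congr fun t => ?_
  simp [h0, logPolar_eq, Real.exp_neg, hw]

lemma eventually_atBot_forall_logPolar {p : ℂ → Prop} (hp : ∀ᶠ z in 𝓝 (0 : ℂ), p z) :
    ∀ᶠ t in atBot, ∀ θ, p (logPolar t θ) := by
  obtain ⟨ε, hε, h⟩ := Metric.eventually_nhds_iff_ball.1 hp
  filter_upwards [Real.tendsto_exp_atBot.eventually (gt_mem_nhds hε)] with t ht θ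
  exact h _ (by simpa [norm_logPolar] using ht)

lemma tendsto_logPolar_atBot (θ : ℝ) : Tendsto (fun t => logPolar t θ) atBot (𝓝 0) := by
  intro s hs
  exact (eventually_atBot_forall_logPolar (p := (· ∈ s)) hs).mono fun t ht => ht θ

lemma tendsto_exp_neg_smul_fderiv_logPolar {ψ : ℂ → ℂ} (hψ : ContDiffOn ℝ 2 ψ (ball 0 1))
    (w : ℂ) (θ : ℝ) :
    Tendsto (fun t => Real.exp (-t) • fderiv ℝ ψ (logPolar t θ) (w * logPolar t θ)) atBot
      (𝓝 (fderiv ℝ ψ 0 (w * Complex.exp (θ * Complex.I)))) := by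
  have hD : ContDiffOn ℝ 1 (fderiv ℝ ψ) (ball 0 1) := hψ.fderiv_of_isOpen isOpen_ball (by norm_num)
  have hc : ContinuousAt (fderiv ℝ ψ) 0 :=
    hD.continuousOn.continuousAt (ball_mem_nhds _ one_pos)
  have h := ((ContinuousLinearMap.apply ℝ ℂ
    (w * Complex.exp (θ * Complex.I))).continuous.tendsto _).comp
    (hc.tendsto.comp (tendsto_logPolar_atBot θ))
  refine h.congr fun t => ?_
  have h1 : w * Complex.exp (θ * Complex.I) = Real.exp (-t) • (w * logPolar t θ) := by
    rw [logPolar_eq, Complex.real_smul, mul_left_comm w, ← mul_assoc, ← Complex.ofReal_mul,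
      ← Real.exp_add]
    simp
  rw [← map_smul, ← h1]
  rfl

lemma eventually_norm_comp_logPolar_le {ψ : ℂ → ℂ} (hψ : ContDiffOn ℝ 2 ψ (ball 0 1))
    (h0 : ψ 0 = 0) :
    ∃ C : ℝ, 0 ≤ C ∧ ∀ᶠ t in atBot, ∀ θ, ‖ψ (logPolar t θ)‖ ≤ C * Real.exp t ∧
      ∀ w : ℂ, ‖w‖ = 1 → ‖fderiv ℝ ψ (logPolar t θ) (w * logPolar t θ)‖ ≤ C * Real.exp t := by
  have hD : ContDiffOn ℝ 1 (fderiv ℝ ψ) (ball 0 1) := hψ.fderiv_of_isOpen isOpen_ball (by norm_num)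
  have hc : ContinuousAt (fderiv ℝ ψ) 0 :=
    hD.continuousOn.continuousAt (ball_mem_nhds _ one_pos)
  have hd : HasFDerivAt ψ (fderiv ℝ ψ 0) 0 :=
    ((hψ.differentiableOn (by norm_num)).differentiableAt (ball_mem_nhds _ one_pos)).hasFDerivAt
  obtain ⟨C, hC⟩ := hd.isBigO_sub.bound
  have h1 : ∀ᶠ z in 𝓝 (0 : ℂ), ‖fderiv ℝ ψ z‖ < ‖fderiv ℝ ψ 0‖ + 1 :=
    hc.norm.eventually (gt_mem_nhds (lt_add_one _))
  refine ⟨max C (‖fderiv ℝ ψ 0‖ + 1), le_max_of_le_right (by positivity), ?_⟩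
  filter_upwards [eventually_atBot_forall_logPolar hC, eventually_atBot_forall_logPolar h1]
    with t h2 h3 θ
  constructor
  · have := h2 θ
    simp only [h0, sub_zero, norm_logPolar] at this
    exact this.trans (by gcongr; exact le_max_left _ _)
  · intro w hw
    refine (ContinuousLinearMap.le_opNorm _ _).trans ?_
    rw [norm_mul, hw, one_mul, norm_logPolar]
    gcongr
    exact (h3 θ).le.trans (le_max_right _ _)

/-- Properties of the profile `φ(t) = f(exp t)` of the degree-one equivariant solution in the
logarithmic radial variable. -/
lemma exists_logarithmic_profile {lam : ℝ} (hlam : 0 < lam) {f : ℝ → ℝ}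
    (hf1 : f 1 = 1) (hfpos : ∀ r ∈ Ioc (0 : ℝ) 1, 0 < f r ∧ 0 < deriv f r)
    {u : ℂ → ℂ} (hu : ∀ t θ, u (logPolar t θ) = f (Real.exp t) * Complex.exp (θ * Complex.I))
    (hu0 : u 0 = 0) (huC2 : ContDiffOn ℝ 2 u (ball 0 1))
    (huSol : ∀ x ∈ ball (0 : ℂ) 1,
      -lap u x = (lam : ℂ) * ((1 - ‖u x‖ ^ 2 : ℝ) : ℂ) * u x) :
    ∃ φ' φ'' : ℝ → ℝ, ∃ c : ℝ, 0 < c ∧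
      (∀ t < 0, HasDerivAt (fun t => f (Real.exp t)) (φ' t) t) ∧
      (∀ t < 0, HasDerivAt φ' (φ'' t) t) ∧ ContinuousOn φ'' (Iio 0) ∧ (∀ t < 0, 0 < φ' t) ∧
      (∀ t < 0, φ'' t = f (Real.exp t) * (1 - lam * Real.exp t ^ 2 * (1 - f (Real.exp t) ^ 2))) ∧
      Tendsto (fun t => Real.exp (-t) * f (Real.exp t)) atBot (𝓝 c) ∧
      Tendsto (fun t => Real.exp (-t) * φ' t) atBot (𝓝 c) := by
  have hU := halfCylinderC2_comp_logPolar huC2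
  set φ : ℝ → ℝ := fun t => f (Real.exp t) with hφ
  have hmem : ∀ t < (0 : ℝ), Real.exp t ∈ Ioc (0 : ℝ) 1 := fun t ht =>
    ⟨Real.exp_pos t, Real.exp_le_one_iff.2 ht.le⟩
  have hφpos : ∀ t < 0, 0 < φ t := fun t ht => (hfpos _ (hmem t ht)).1
  have hre : ∀ t, φ t = (u (logPolar t 0)).re := by
    intro t
    simp [hu, hφ]
  set Ut : ℝ → ℂ := fun t => fderiv ℝ u (logPolar t 0) (logPolar t 0) with hUt
  set Utt : ℝ → ℂ := fun t => fderiv ℝ (fderiv ℝ u) (logPolar t 0) (logPolar t 0) (logPolar t 0)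
        + fderiv ℝ u (logPolar t 0) (logPolar t 0) with hUtt
  have d1 : ∀ t < 0, HasDerivAt φ (Ut t).re t := by
    intro t ht
    have := Complex.reCLM.hasFDerivAt.comp_hasDerivAt t (hU.dt t ht 0)
    exact this.congr_of_eventuallyEq (Eventually.of_forall hre)
  have d2 : ∀ t < 0, HasDerivAt (fun t => (Ut t).re) (Utt t).re t := fun t ht =>
    Complex.reCLM.hasFDerivAt.comp_hasDerivAt t (hU.dtt t ht 0)
  have cφ'' : ContinuousOn (fun t => (Utt t).re) (Iio 0) := by
    have : ContinuousOn (fun t : ℝ => Utt t) (Iio 0) :=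
      hU.cVtt.comp (f := fun t : ℝ => (t, (0 : ℝ))) (by fun_prop) (fun t ht => ⟨ht, mem_univ _⟩)
    exact Complex.continuous_re.comp_continuousOn this
  have hφ'pos : ∀ t < 0, 0 < (Ut t).re := by
    intro t ht
    have h1 := (hfpos _ (hmem t ht)).2
    have h2 : HasDerivAt f (deriv f (Real.exp t)) (Real.exp t) :=
      (differentiableAt_of_deriv_ne_zero h1.ne').hasDerivAt
    rw [(d1 t ht).unique (h2.comp t (Real.hasDerivAt_exp t))]
    exact mul_pos h1 (Real.exp_pos t)
  have hode : ∀ t < 0, (Utt t).re = φ t * (1 - lam * Real.exp t ^ 2 * (1 - φ t ^ 2)) := by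
    intro t ht
    have e1 : ∀ θ : ℝ, HasDerivAt (fun θ : ℝ => (φ t : ℂ) * Complex.exp (θ * Complex.I))
        (φ t * Complex.exp (θ * Complex.I) * Complex.I) θ := by
      intro θ
      have h := ((Complex.ofRealCLM.hasDerivAt (x := θ)).mul_const Complex.I).cexp.const_mul
        (φ t : ℂ)
      refine h.congr_deriv ?_
      simp
      ring
    have e2 : ∀ θ : ℝ, fderiv ℝ u (logPolar t θ) (Complex.I * logPolar t θ)
        = φ t * Complex.exp (θ * Complex.I) * Complex.I := by
      intro θ
      refine (hU.dθ t ht θ).unique ((e1 θ).congr_of_eventuallyEq ?_)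
      exact Eventually.of_forall fun s => hu t s
    have e3 := (hU.dθθ t ht 0).unique
      (((e1 0).mul_const Complex.I).congr_of_eventuallyEq (Eventually.of_forall e2))
    have e4 := logPolar_laplacian huC2 ht 0
    rw [e3, ← neg_neg (lap u _), huSol _ (logPolar_mem_ball ht 0), hu] at e4
    have e5 := congrArg Complex.re e4
    have e6 : ‖(f (Real.exp t) : ℂ) * Complex.exp ((0 : ℝ) * Complex.I)‖ ^ 2 = φ t ^ 2 := by
      simp [hφ]
    rw [e6] at e5
    have e7 : (φ t : ℂ) * Complex.exp ((0 : ℝ) * Complex.I) * Complex.I * Complex.I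
        = ((-φ t : ℝ) : ℂ) := by
      rw [mul_assoc, Complex.I_mul_I]; simp
    have e8 : ((Real.exp t ^ 2 : ℝ) : ℂ) * -((lam : ℂ) * ((1 - φ t ^ 2 : ℝ) : ℂ) *
        ((f (Real.exp t) : ℂ) * Complex.exp ((0 : ℝ) * Complex.I)))
        = ((-(Real.exp t ^ 2 * (lam * (1 - φ t ^ 2) * φ t)) : ℝ) : ℂ) := by
      simp [hφ]
    rw [e7, e8, Complex.add_re, Complex.ofReal_re, Complex.ofReal_re] at e5
    have e9 : (Utt t).re + -φ t = -(Real.exp t ^ 2 * (lam * (1 - φ t ^ 2) * φ t)) := e5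
    linarith
  have hfmono : StrictMonoOn f (Ioc 0 1) := by
    refine strictMonoOn_of_deriv_pos (convex_Ioc _ _) ?_ fun r hr => (hfpos r (interior_subset hr)).2
    intro r hr
    exact (differentiableAt_of_deriv_ne_zero (hfpos r hr).2.ne').continuousAt.continuousWithinAt
  have hφle : ∀ t < 0, φ t ≤ 1 := by
    intro t ht
    have := hfmono.monotoneOn (hmem t ht) ⟨one_pos, le_rfl⟩ (hmem t ht).2
    rwa [hf1] at this
  have hdu : HasFDerivAt u (fderiv ℝ u 0) 0 :=
    ((huC2.differentiableOn (by norm_num)).differentiableAt (ball_mem_nhds _ one_pos)).hasFDerivAt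
  have l1 : Tendsto (fun t => Real.exp (-t) * φ t) atBot (𝓝 (fderiv ℝ u 0 1).re) := by
    have h := (Complex.continuous_re.tendsto _).comp (tendsto_exp_neg_mul_comp_logPolar hdu hu0 0)
    simp only [Complex.ofReal_zero, zero_mul, Complex.exp_zero] at h
    refine h.congr fun t => ?_
    simp only [Function.comp, Complex.smul_re, smul_eq_mul, hre]
  have l2 : Tendsto (fun t => Real.exp (-t) * (Ut t).re) atBot (𝓝 (fderiv ℝ u 0 1).re) := by
    have h := (Complex.continuous_re.tendsto _).comp
      (tendsto_exp_neg_smul_fderiv_logPolar huC2 1 0)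
    simp only [Complex.ofReal_zero, zero_mul, Complex.exp_zero, one_mul] at h
    refine h.congr fun t => ?_
    simp only [Function.comp, Complex.smul_re, smul_eq_mul, hUt]
  -- `f(r) / r` is nonincreasing
  have hy : ∀ t < 0, (Ut t).re - φ t ≤ 0 := by
    set y : ℝ → ℝ := fun t => Real.exp t * ((Ut t).re - φ t) with hydef
    have dy : ∀ t < 0, HasDerivAt y (Real.exp t * ((Ut t).re - φ t)
        + Real.exp t * ((Utt t).re - (Ut t).re)) t := fun t ht =>
      (Real.hasDerivAt_exp t).mul ((d2 t ht).sub (d1 t ht))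
    have hanti : AntitoneOn y (Iio 0) := by
      refine antitoneOn_of_deriv_nonpos (convex_Iio _)
        (fun t ht => (dy t ht).continuousAt.continuousWithinAt)
        (fun t ht => (dy t (by simpa using ht)).differentiableAt.differentiableWithinAt) ?_
      intro t ht
      replace ht : t < 0 := by simpa using ht
      rw [(dy t ht).deriv, hode t ht]
      have h1 := hφpos t ht
      have h2 := hφle t ht
      have h3 : 0 ≤ 1 - φ t ^ 2 := by nlinarith
      have h4 : 0 ≤ Real.exp t * (φ t * (lam * Real.exp t ^ 2 * (1 - φ t ^ 2))) := by positivity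
      linarith
    have hylim : Tendsto y atBot (𝓝 0) := by
      have h1 := (l2.sub l1).mul (Real.tendsto_exp_atBot.pow 2)
      simp only [sub_self, zero_mul] at h1
      refine h1.congr fun t => ?_
      have h2 : Real.exp (-t) * Real.exp t = 1 := by rw [← Real.exp_add]; simp
      simp only [hydef]
      linear_combination (Real.exp t * ((Ut t).re - φ t)) * h2
    intro t ht
    have h1 : y t ≤ 0 := by
      refine ge_of_tendsto hylim ?_
      filter_upwards [Iic_mem_atBot t] with s hs
      exact hanti (lt_of_le_of_lt hs ht) ht hs
    exact nonpos_of_mul_nonpos_right h1 (Real.exp_pos t)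
  refine ⟨fun t => (Ut t).re, fun t => (Utt t).re, (fderiv ℝ u 0 1).re, ?_, d1, d2, cφ'', hφ'pos,
    hode, l1, l2⟩
  have dx : ∀ t < 0, HasDerivAt (fun t => Real.exp (-t) * φ t)
      (Real.exp (-t) * -1 * φ t + Real.exp (-t) * (Ut t).re) t := fun t ht =>
    ((hasDerivAt_neg t).exp).mul (d1 t ht)
  have hanti : AntitoneOn (fun t => Real.exp (-t) * φ t) (Iio 0) := by
    refine antitoneOn_of_deriv_nonpos (convex_Iio _)
      (fun t ht => (dx t ht).continuousAt.continuousWithinAt)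
      (fun t ht => (dx t (by simpa using ht)).differentiableAt.differentiableWithinAt) ?_
    intro t ht
    replace ht : t < 0 := by simpa using ht
    rw [(dx t ht).deriv]
    have := mul_nonpos_of_nonneg_of_nonpos (Real.exp_pos (-t)).le (hy t ht)
    linarith
  have hm1 : (-1 : ℝ) < 0 := by norm_num
  refine lt_of_lt_of_le (mul_pos (Real.exp_pos (- -1)) (hφpos (-1) hm1)) (ge_of_tendsto l1 ?_)
  filter_upwards [Iic_mem_atBot (-1 : ℝ)] with s hs
  exact hanti (lt_of_le_of_lt hs hm1) hm1 hs

lemma integral_norm_sq_rotate (L : ℂ →L[ℝ] ℂ) :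
    ∫ θ in (0 : ℝ)..2 * Real.pi, ‖L (Complex.I * Complex.exp (θ * Complex.I))‖ ^ 2
      = ∫ θ in (0 : ℝ)..2 * Real.pi, ‖L (Complex.exp (θ * Complex.I))‖ ^ 2 := by
  set h : ℝ → ℝ := fun θ => ‖L (Complex.exp (θ * Complex.I))‖ ^ 2 with hh
  have hper : Function.Periodic h (2 * Real.pi) := by
    intro θ
    simp only [hh]
    push_cast
    rw [add_mul, Complex.exp_add, Complex.exp_two_pi_mul_I, mul_one]
  have hrot : ∀ θ : ℝ, ‖L (Complex.I * Complex.exp (θ * Complex.I))‖ ^ 2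
      = h (θ + Real.pi / 2) := by
    intro θ
    simp only [hh]
    push_cast
    rw [add_mul, Complex.exp_add, Complex.exp_pi_div_two_mul_I, mul_comm]
  simp only [hrot]
  rw [intervalIntegral.integral_comp_add_right, add_comm (2 * Real.pi), zero_add,
    hper.intervalIntegral_add_eq (Real.pi / 2) 0, zero_add]

/-- The Hopf differential of a renormalized map vanishing at the origin averages out on small
circles. -/
lemma tendsto_integral_smul_comp_logPolar {ψ : ℂ → ℂ} (hψ : ContDiffOn ℝ 2 ψ (ball 0 1))
    (h0 : ψ 0 = 0) {g g' : ℝ → ℝ} {d : ℝ} (hg : Tendsto (fun t => Real.exp t * g t) atBot (𝓝 d))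
    (hg' : Tendsto (fun t => Real.exp t * g' t) atBot (𝓝 (-d))) :
    Tendsto (fun t => ∫ θ in (0 : ℝ)..2 * Real.pi,
      (‖g t • fderiv ℝ ψ (logPolar t θ) (logPolar t θ) + g' t • ψ (logPolar t θ)‖ ^ 2
        - ‖g t • fderiv ℝ ψ (logPolar t θ) (Complex.I * logPolar t θ)‖ ^ 2
        + ‖g t • ψ (logPolar t θ)‖ ^ 2)) atBot (𝓝 0) := by
  have hU := halfCylinderC2_comp_logPolar hψ
  have hd : HasFDerivAt ψ (fderiv ℝ ψ 0) 0 :=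
    ((hψ.differentiableOn (by norm_num)).differentiableAt (ball_mem_nhds _ one_pos)).hasFDerivAt
  set L := fderiv ℝ ψ 0 with hL
  have hexp : ∀ (t x : ℝ) (z : ℂ), (Real.exp t * x) • (Real.exp (-t) • z) = x • z := by
    intro t x z
    rw [smul_smul, mul_right_comm, ← Real.exp_add]
    simp
  have lV : ∀ θ : ℝ, Tendsto (fun t => g t • ψ (logPolar t θ)) atBot
      (𝓝 (d • L (Complex.exp (θ * Complex.I)))) := fun θ =>
    (hg.smul (tendsto_exp_neg_mul_comp_logPolar hd h0 θ)).congr fun t => hexp _ _ _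
  have lVθ : ∀ θ : ℝ, Tendsto (fun t => g t • fderiv ℝ ψ (logPolar t θ) (Complex.I * logPolar t θ))
      atBot (𝓝 (d • L (Complex.I * Complex.exp (θ * Complex.I)))) := fun θ =>
    (hg.smul (tendsto_exp_neg_smul_fderiv_logPolar hψ Complex.I θ)).congr fun t => hexp _ _ _
  have lVt : ∀ θ : ℝ, Tendsto (fun t => g t • fderiv ℝ ψ (logPolar t θ) (logPolar t θ)
      + g' t • ψ (logPolar t θ)) atBot (𝓝 0) := by
    intro θ
    have h := (hg.smul (tendsto_exp_neg_smul_fderiv_logPolar hψ 1 θ)).add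
      (hg'.smul (tendsto_exp_neg_mul_comp_logPolar hd h0 θ))
    simp only [one_mul, hexp, neg_smul] at h
    rwa [← hL, add_neg_cancel] at h
  have key := intervalIntegral.tendsto_integral_filter_of_dominated_convergence
    (μ := volume) (l := atBot) (a := 0) (b := 2 * Real.pi)
    (F := fun t θ => ‖g t • fderiv ℝ ψ (logPolar t θ) (logPolar t θ) + g' t • ψ (logPolar t θ)‖ ^ 2
        - ‖g t • fderiv ℝ ψ (logPolar t θ) (Complex.I * logPolar t θ)‖ ^ 2
        + ‖g t • ψ (logPolar t θ)‖ ^ 2)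
    (f := fun θ => ‖(0 : ℂ)‖ ^ 2 - ‖d • L (Complex.I * Complex.exp (θ * Complex.I))‖ ^ 2
      + ‖d • L (Complex.exp (θ * Complex.I))‖ ^ 2)
  have hlim : ∫ θ in (0 : ℝ)..2 * Real.pi, (‖(0 : ℂ)‖ ^ 2
      - ‖d • L (Complex.I * Complex.exp (θ * Complex.I))‖ ^ 2
      + ‖d • L (Complex.exp (θ * Complex.I))‖ ^ 2) = 0 := by
    rw [intervalIntegral.integral_congr (g := fun θ : ℝ =>
      ‖(d • L) (Complex.exp (θ * Complex.I))‖ ^ 2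
        - ‖(d • L) (Complex.I * Complex.exp (θ * Complex.I))‖ ^ 2),
      intervalIntegral.integral_sub, integral_norm_sq_rotate, sub_self]
    · exact Continuous.intervalIntegrable (by fun_prop) _ _
    · exact Continuous.intervalIntegrable (by fun_prop) _ _
    · intro θ _
      simp only [smul_apply, norm_zero]
      ring
  rw [hlim] at key
  obtain ⟨C, hC0, hC⟩ := eventually_norm_comp_logPolar_le hψ h0
  have hgb : ∀ᶠ t in atBot, |Real.exp t * g t| < |d| + 1 :=
    hg.abs.eventually (gt_mem_nhds (lt_add_one _))
  have hgb' : ∀ᶠ t in atBot, |Real.exp t * g' t| < |d| + 1 := by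
    refine hg'.abs.eventually (gt_mem_nhds ?_)
    rw [abs_neg]
    exact lt_add_one _
  set M := (|d| + 1) * C with hM
  have hbd : ∀ (t x : ℝ) (z : ℂ), |Real.exp t * x| < |d| + 1 → ‖z‖ ≤ C * Real.exp t →
      ‖x • z‖ ≤ M := by
    intro t x z h1 h2
    rw [norm_smul, Real.norm_eq_abs]
    rw [abs_mul, abs_of_pos (Real.exp_pos t)] at h1
    calc |x| * ‖z‖ ≤ |x| * (C * Real.exp t) := by gcongr
      _ = Real.exp t * |x| * C := by ring
      _ ≤ M := by rw [hM]; gcongr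
  refine key (fun _ => 6 * M ^ 2) ?_ ?_ (by simp) ?_
  · filter_upwards [Iio_mem_atBot (0 : ℝ)] with t ht
    have c1 := continuous_slice hU.cV ht
    have c2 := continuous_slice hU.cVt ht
    have c3 := continuous_slice hU.cVθ ht
    exact ((((c2.const_smul (g t)).add (c1.const_smul (g' t))).norm.pow 2).sub
      ((c3.const_smul (g t)).norm.pow 2)).add ((c1.const_smul (g t)).norm.pow 2)
        |>.aestronglyMeasurable
  · filter_upwards [hC, hgb, hgb'] with t h1 h2 h3
    refine Eventually.of_forall fun θ _ => ?_
    obtain ⟨h4, h5⟩ := h1 θ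
    have h6 := h5 1 (by simp)
    have h7 := h5 Complex.I (by simp)
    rw [one_mul] at h6
    have b1 := hbd t _ _ h2 h4
    have b2 := hbd t _ _ h2 h6
    have b3 := hbd t _ _ h2 h7
    have b4 := hbd t _ _ h3 h4
    have b5 := (norm_add_le _ _).trans (add_le_add b2 b4)
    have s1 := pow_le_pow_left₀ (norm_nonneg _) b1 2
    have s3 := pow_le_pow_left₀ (norm_nonneg _) b3 2
    have s5 := pow_le_pow_left₀ (norm_nonneg _) b5 2
    rw [Real.norm_eq_abs, abs_le]
    constructor
    · nlinarith [sq_nonneg M, sq_nonneg ‖g t • ψ (logPolar t θ)‖,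
        sq_nonneg ‖g t • fderiv ℝ ψ (logPolar t θ) (logPolar t θ) + g' t • ψ (logPolar t θ)‖]
    · nlinarith [sq_nonneg ‖g t • fderiv ℝ ψ (logPolar t θ) (Complex.I * logPolar t θ)‖]
  · exact Eventually.of_forall fun θ _ =>
      (((lVt θ).norm.pow 2).sub ((lVθ θ).norm.pow 2)).add ((lV θ).norm.pow 2)

/-- The nonlinearity of the renormalized two-component system. -/
def renormalizedNonlinearity (β : ℝ) (x : WithLp 2 (ℂ × ℂ)) : WithLp 2 (ℂ × ℂ) :=
  WithLp.toLp 2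
    (((1 - (‖x.fst‖ ^ 2 + ‖x.snd‖ ^ 2) / 2) + β / 2 * (‖x.snd‖ ^ 2 - ‖x.fst‖ ^ 2)) • x.fst,
      ((1 - (‖x.fst‖ ^ 2 + ‖x.snd‖ ^ 2) / 2) - β / 2 * (‖x.snd‖ ^ 2 - ‖x.fst‖ ^ 2)) • x.snd)

/-- The potential of `renormalizedNonlinearity`, normalized to vanish at its minima. -/
def renormalizedPotential (β : ℝ) (x : WithLp 2 (ℂ × ℂ)) : ℝ :=
  (1 - (‖x.fst‖ ^ 2 + ‖x.snd‖ ^ 2) / 2) ^ 2 / 2 + β / 8 * (‖x.snd‖ ^ 2 - ‖x.fst‖ ^ 2) ^ 2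

lemma continuous_renormalizedNonlinearity (β : ℝ) : Continuous (renormalizedNonlinearity β) := by
  unfold renormalizedNonlinearity
  fun_prop

lemma continuous_renormalizedPotential (β : ℝ) : Continuous (renormalizedPotential β) := by
  unfold renormalizedPotential
  fun_prop

lemma hasDerivAt_renormalizedPotential (β : ℝ) {γ : ℝ → WithLp 2 (ℂ × ℂ)} {γ' : WithLp 2 (ℂ × ℂ)}
    {t : ℝ} (hγ : HasDerivAt γ γ' t) :
    HasDerivAt (fun s => renormalizedPotential β (γ s))
      (-inner ℝ (renormalizedNonlinearity β (γ t)) γ') t := by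
  have h := (WithLp.prodContinuousLinearEquiv 2 ℝ ℂ ℂ).hasFDerivAt.comp_hasDerivAt t hγ
  have h1 : HasDerivAt (fun s => (γ s).fst) γ'.fst t :=
    (ContinuousLinearMap.fst ℝ ℂ ℂ).hasFDerivAt.comp_hasDerivAt t h
  have h2 : HasDerivAt (fun s => (γ s).snd) γ'.snd t :=
    (ContinuousLinearMap.snd ℝ ℂ ℂ).hasFDerivAt.comp_hasDerivAt t h
  have q1 := h1.norm_sq
  have q2 := h2.norm_sq
  have := ((((q1.add q2).div_const 2).const_sub 1).pow 2 |>.div_const 2).add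
    (((q2.sub q1).pow 2).const_mul (β / 8))
  refine this.congr_deriv ?_
  rw [WithLp.prod_inner_apply]
  simp only [renormalizedNonlinearity, inner_smul_left, WithLp.fst, WithLp.snd]
  simp
  ring

lemma renormalized_component_equation {φ φ' φ'' ρ lam ν s : ℝ} (hφ : φ ≠ 0)
    (hode : φ'' = φ * (1 - lam * ρ ^ 2 * (1 - φ ^ 2))) {P Pt Ptt Pθθ : ℂ}
    (h : Ptt + Pθθ = -(((ρ ^ 2 * (lam * (1 - φ ^ 2) + lam * φ ^ 2 * ν) : ℝ) : ℂ) * P)) :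
    φ • ((s / φ) • Ptt + (-(s * φ') / φ ^ 2) • Pt + ((-(s * φ') / φ ^ 2) • Pt
        + (s * (2 * φ' ^ 2 / φ ^ 3 - φ'' / φ ^ 2)) • P) + (s / φ) • Pθθ + (s / φ) • P
        + (lam * ρ ^ 2 * φ ^ 2) • (ν • ((s / φ) • P)))
      + (2 * φ') • ((s / φ) • Pt + (-(s * φ') / φ ^ 2) • P) = 0 := by
  rw [eq_sub_of_add_eq' h, hode]
  simp only [Complex.real_smul]
  push_cast
  have : (φ : ℂ) ≠ 0 := by exact_mod_cast hφ
  field_simp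
  ring

lemma hasDerivAt_exp_ofReal_mul_I (θ : ℝ) :
    HasDerivAt (fun θ : ℝ => Complex.exp (θ * Complex.I))
      (Complex.I * Complex.exp (θ * Complex.I)) θ := by
  have := hasDerivAt_logPolar_snd 0 θ
  have h : logPolar 0 = fun θ : ℝ => Complex.exp (θ * Complex.I) := by
    funext θ; simp [logPolar_eq]
  rwa [h] at this

lemma DPSolution.renormalized_eq {lam β : ℝ} (hlam : 0 < lam) (hβ : 0 < β) {f : ℝ → ℝ}
    (hf1 : f 1 = 1) (hfpos : ∀ r ∈ Ioc (0 : ℝ) 1, 0 < f r ∧ 0 < deriv f r) {u : ℂ → ℂ}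
    (hu : ∀ t θ, u (logPolar t θ) = f (Real.exp t) * Complex.exp (θ * Complex.I)) (hu0 : u 0 = 0)
    (huC2 : ContDiffOn ℝ 2 u (ball 0 1))
    (huSol : ∀ x ∈ ball (0 : ℂ) 1,
      -lap u x = (lam : ℂ) * ((1 - ‖u x‖ ^ 2 : ℝ) : ℂ) * u x)
    {ψp ψm : ℂ → ℂ} (hΨ : DPSolution lam β ψp ψm) (h0p : ψp 0 = 0) (h0m : ψm 0 = 0)
    {t θ : ℝ} (ht : t < 0) (hθ : θ ∈ Icc 0 (2 * Real.pi)) :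
    (Real.sqrt 2 / f (Real.exp t)) • ψp (logPolar t θ) = Complex.exp (θ * Complex.I) ∧
      (Real.sqrt 2 / f (Real.exp t)) • ψm (logPolar t θ) = Complex.exp (θ * Complex.I) := by
  obtain ⟨cp, cm, hp, hm, hsol, hbd⟩ := hΨ
  obtain ⟨φ', φ'', c, hc, dφ, dφ', cφ'', hφ', hode, l1, l2⟩ :=
    exists_logarithmic_profile hlam hf1 hfpos hu hu0 huC2 huSol
  set φ : ℝ → ℝ := fun t => f (Real.exp t) with hφdef
  set s := Real.sqrt 2 with hs
  have hspos : 0 < s := by positivity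
  have hs2 : s ^ 2 = 2 := Real.sq_sqrt (by norm_num)
  have hmem : ∀ t ≤ (0 : ℝ), Real.exp t ∈ Ioc (0 : ℝ) 1 := fun t ht =>
    ⟨Real.exp_pos t, Real.exp_le_one_iff.2 ht⟩
  have hφpos : ∀ t ≤ 0, 0 < φ t := fun t ht => (hfpos _ (hmem t ht)).1
  have cφ : ContinuousOn φ (Iic 0) := fun t ht =>
    ((differentiableAt_of_deriv_ne_zero (hfpos _ (hmem t ht)).2.ne').continuousAt.comp
      Real.continuous_exp.continuousAt).continuousWithinAt
  have cφ' : ContinuousOn φ' (Iio 0) := fun t ht => (dφ' t ht).continuousAt.continuousWithinAt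
  have cφ0 : ContinuousOn φ (Iio 0) := cφ.mono Iio_subset_Iic_self
  -- the renormalization factor `√2 / φ` and its derivatives
  have dg : ∀ t < 0, HasDerivAt (fun t => s / φ t) (-(s * φ' t) / φ t ^ 2) t := by
    intro t ht
    refine ((hasDerivAt_const t s).div (dφ t ht) (hφpos t ht.le).ne').congr_deriv ?_
    simp
  have dg' : ∀ t < 0, HasDerivAt (fun t => -(s * φ' t) / φ t ^ 2)
      (s * (2 * φ' t ^ 2 / φ t ^ 3 - φ'' t / φ t ^ 2)) t := by
    intro t ht
    have hne := (hφpos t ht.le).ne'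
    refine ((((dφ' t ht).const_mul s).neg).div ((dφ t ht).pow 2) (pow_ne_zero 2 hne)).congr_deriv ?_
    simp only [Pi.neg_apply, Pi.pow_apply]
    field_simp
    ring
  have cg'' : ContinuousOn (fun t => s * (2 * φ' t ^ 2 / φ t ^ 3 - φ'' t / φ t ^ 2)) (Iio 0) := by
    refine continuousOn_const.mul (ContinuousOn.sub ?_ ?_)
    · exact (continuousOn_const.mul (cφ'.pow 2)).div (cφ0.pow 3)
        fun t ht => pow_ne_zero 3 (hφpos t (le_of_lt ht)).ne'
    · exact cφ''.div (cφ0.pow 2) fun t ht => pow_ne_zero 2 (hφpos t (le_of_lt ht)).ne'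
  have lg : Tendsto (fun t => Real.exp t * (s / φ t)) atBot (𝓝 (s / c)) := by
    refine (tendsto_const_nhds.div l1 hc.ne').congr fun t => ?_
    change s / (Real.exp (-t) * φ t) = Real.exp t * (s / φ t)
    rw [Real.exp_neg, inv_mul_eq_div, div_div_eq_mul_div, mul_comm s, mul_div_assoc]
  have lg' : Tendsto (fun t => Real.exp t * (-(s * φ' t) / φ t ^ 2)) atBot (𝓝 (-(s / c))) := by
    have h := ((l2.const_mul s).neg).div (l1.pow 2) (pow_ne_zero 2 hc.ne')
    have h1 : -(s * c) / c ^ 2 = -(s / c) := by field_simp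
    rw [h1] at h
    refine h.congr' ?_
    filter_upwards [Iic_mem_atBot (0 : ℝ)] with t ht
    have := (hφpos t ht).ne'
    change -(s * (Real.exp (-t) * φ' t)) / (Real.exp (-t) * φ t) ^ 2
      = Real.exp t * (-(s * φ' t) / φ t ^ 2)
    rw [Real.exp_neg]
    field_simp
  have hVp := (halfCylinderC2_comp_logPolar hp).smul dg dg' cg''
  have hVm := (halfCylinderC2_comp_logPolar hm).smul dg dg' cg''
  have hV := hVp.toLp_prod hVm
  have hclosed : MapsTo (Function.uncurry logPolar) (Iic 0 ×ˢ univ) (closedBall 0 1) := by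
    intro p hp
    simpa [norm_logPolar, Function.uncurry] using hp
  have hVcl : ∀ {ψ : ℂ → ℂ}, ContinuousOn ψ (closedBall 0 1) →
      ContinuousOn (fun p : ℝ × ℝ => (s / φ p.1) • ψ (logPolar p.1 p.2)) (Iic 0 ×ˢ univ) := by
    intro ψ hψ
    have c1 : ContinuousOn (fun p : ℝ × ℝ => φ p.1) (Iic 0 ×ˢ univ) :=
      cφ.comp continuousOn_fst fun p hp => hp.1
    exact (continuousOn_const.div c1 fun p hp => (hφpos p.1 hp.1).ne').smul
      (hψ.comp continuous_logPolar.continuousOn hclosed)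
  have hV0 : ∀ {ψ : ℂ → ℂ}, (∀ x : ℂ, ‖x‖ = 1 → ψ x = (s : ℂ)⁻¹ * x) → ∀ θ : ℝ,
      (s / φ 0) • ψ (logPolar 0 θ) = Complex.exp (θ * Complex.I) := by
    intro ψ hψ θ
    have h1 : φ 0 = 1 := by simp [hφdef, hf1]
    have h2 : logPolar 0 θ = Complex.exp (θ * Complex.I) := by simp [logPolar_eq]
    rw [hψ _ (by simp [norm_logPolar]), h1, h2, div_one, Complex.real_smul, mul_inv_cancel_left₀]
    exact_mod_cast hspos.ne'
  have hexp1 : ∀ θ : ℝ, ‖Complex.exp (θ * Complex.I)‖ = 1 := Complex.norm_exp_ofReal_mul_I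
  have dc : ∀ t < 0, HasDerivAt (fun t => lam * Real.exp t ^ 2 * φ t ^ 2)
      (lam * (2 * Real.exp t ^ 2) * φ t ^ 2
        + lam * Real.exp t ^ 2 * (2 * φ t * φ' t)) t := by
    intro t ht
    refine ((((Real.hasDerivAt_exp t).pow 2).const_mul lam).mul ((dφ t ht).pow 2)).congr_deriv ?_
    simp only [Pi.pow_apply, Nat.cast_ofNat, Nat.add_one_sub_one, pow_one]
    ring
  have hmain := hV.eq_boundary_datum (n := renormalizedNonlinearity β)
    (k := renormalizedPotential β) (φ := φ) (φ' := φ')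
    (continuous_renormalizedNonlinearity β) (continuous_renormalizedPotential β)
    (fun _ _ _ h => hasDerivAt_renormalizedPotential β h)
    (fun x => by unfold renormalizedPotential; positivity)
    (fun t ht => hφpos t ht.le) dφ hφ'
    (c := fun t => lam * Real.exp t ^ 2 * φ t ^ 2)
    (fun t _ => by positivity) dc ?_ ?_ ?_ ?_
    (e := fun θ => WithLp.toLp 2 (Complex.exp (θ * Complex.I), Complex.exp (θ * Complex.I)))
    (e' := fun θ => WithLp.toLp 2 (Complex.I * Complex.exp (θ * Complex.I),
      Complex.I * Complex.exp (θ * Complex.I)))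
    (fun θ => (hasDerivAt_exp_ofReal_mul_I θ).toLp_prod (hasDerivAt_exp_ofReal_mul_I θ))
    ?_ ?_ ?_ ((hVcl cp).toLp_prod (hVcl cm)) ?_ ?_ ?_ ht hθ
  · exact ⟨congrArg WithLp.fst hmain, congrArg WithLp.snd hmain⟩
  · have c1 : Continuous fun t => lam * (2 * Real.exp t ^ 2) := by fun_prop
    have c2 : Continuous fun t => lam * Real.exp t ^ 2 := by fun_prop
    exact (c1.continuousOn.mul (cφ0.pow 2)).add
      (c2.continuousOn.mul ((continuousOn_const.mul cφ0).mul cφ'))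
  · intro t ht
    have := hφpos t ht.le
    have := hφ' t ht
    positivity
  · have c2 : Continuous fun t => lam * Real.exp t ^ 2 := by fun_prop
    exact c2.continuousOn.mul (cφ.pow 2)
  · intro t ht θ
    have hne := (hφpos t ht.le).ne'
    obtain ⟨e1, e2⟩ := hsol _ (logPolar_mem_ball ht θ)
    have lp := logPolar_laplacian hp ht θ
    have lm := logPolar_laplacian hm ht θ
    have nrm : ∀ z : ℂ, ‖z‖ ^ 2 = φ t ^ 2 * ‖(s / φ t) • z‖ ^ 2 / 2 := by
      intro z
      rw [norm_smul, mul_pow, Real.norm_eq_abs, sq_abs, div_pow, hs2]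
      field_simp
    apply WithLp.ofLp_injective 2
    apply Prod.ext
    · refine renormalized_component_equation (lam := lam) (ρ := Real.exp t) hne (hode t ht) ?_
      rw [lp, ← neg_neg (lap ψp _), e1, nrm (ψp _), nrm (ψm _)]
      simp only [WithLp.fst, WithLp.snd]
      push_cast
      ring
    · refine renormalized_component_equation (lam := lam) (ρ := Real.exp t) hne (hode t ht) ?_
      rw [lm, ← neg_neg (lap ψm _), e2, nrm (ψp _), nrm (ψm _)]
      simp only [WithLp.fst, WithLp.snd]
      push_cast
      ring
  · intro θ
    have h := (hasDerivAt_exp_ofReal_mul_I θ).const_mul Complex.I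
    have h1 : Complex.I * (Complex.I * Complex.exp (θ * Complex.I))
        = -Complex.exp (θ * Complex.I) := by
      rw [← mul_assoc, Complex.I_mul_I]; ring
    rw [h1] at h
    exact h.toLp_prod h
  · simp [Complex.exp_two_pi_mul_I]
  · simp [Complex.exp_two_pi_mul_I]
  · intro θ
    simp only [hV0 (fun x hx => (hbd x hx).1), hV0 (fun x hx => (hbd x hx).2)]
  · intro θ
    simp [renormalizedPotential, hexp1]
  · have h := (tendsto_integral_smul_comp_logPolar hp h0p lg lg').add
      (tendsto_integral_smul_comp_logPolar hm h0m lg lg')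
    rw [add_zero] at h
    refine h.congr' ?_
    filter_upwards [Iio_mem_atBot (0 : ℝ)] with t ht
    have cint : ∀ {V Vt Vθ Vtt Vtθ Vθθ : ℝ → ℝ → ℂ}, HalfCylinderC2 V Vt Vθ Vtt Vtθ Vθθ →
        IntervalIntegrable (fun θ => ‖Vt t θ‖ ^ 2 - ‖Vθ t θ‖ ^ 2 + ‖V t θ‖ ^ 2) volume 0
          (2 * Real.pi) := fun h =>
      (((((continuous_slice h.cVt ht).norm.pow 2).sub ((continuous_slice h.cVθ ht).norm.pow 2)).add
        ((continuous_slice h.cV ht).norm.pow 2))).intervalIntegrable _ _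
    rw [← intervalIntegral.integral_add (cint hVp) (cint hVm)]
    refine intervalIntegral.integral_congr fun θ _ => ?_
    simp only [WithLp.prod_norm_sq_eq_of_L2, WithLp.fst, WithLp.snd]
    ring

/-- If both components of a solution of (DP) vanish at the origin, then the solution is
the symmetric equivariant one: `ψ₊ = ψ₋ = (1/√2)·u_λ` on the closed unit disk, where
`u_λ(x) = f(|x|)e^{iθ}` is the degree-one equivariant Ginzburg–Landau solution. -/
theorem statement15 (lam β : ℝ) (hlam : 0 < lam) (hβ : 0 < β)
    (f : ℝ → ℝ) (hf0 : f 0 = 0) (hf1 : f 1 = 1)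
    (hfpos : ∀ r ∈ Ioc (0 : ℝ) 1, 0 < f r ∧ 0 < deriv f r)
    (u : ℂ → ℂ)
    (hu : ∀ x : ℂ, u x = (f ‖x‖ : ℂ) * Complex.exp (Complex.I * (Complex.arg x : ℂ)))
    (huC2 : ContDiffOn ℝ 2 u (ball 0 1))
    (huSol : ∀ x ∈ ball (0 : ℂ) 1,
      -lap u x = (lam : ℂ) * ((1 - ‖u x‖ ^ 2 : ℝ) : ℂ) * u x)
    (hub : ∀ x : ℂ, ‖x‖ = 1 → u x = x)
    (ψp ψm : ℂ → ℂ) (hΨ : DPSolution lam β ψp ψm)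
    (h0p : ψp 0 = 0) (h0m : ψm 0 = 0) :
    ∀ x ∈ closedBall (0 : ℂ) 1,
      ψp x = (Real.sqrt 2 : ℂ)⁻¹ * u x ∧ ψm x = (Real.sqrt 2 : ℂ)⁻¹ * u x := by
  have hu' : ∀ t θ, u (logPolar t θ) = f (Real.exp t) * Complex.exp (θ * Complex.I) := by
    intro t θ
    have h := Complex.norm_mul_exp_arg_mul_I (logPolar t θ)
    rw [norm_logPolar] at h
    have hne : (Real.exp t : ℂ) ≠ 0 := by exact_mod_cast (Real.exp_pos t).ne'
    rw [hu, norm_logPolar, mul_comm Complex.I, mul_left_cancel₀ hne (h.trans (logPolar_eq t θ))]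
  have hu0 : u 0 = 0 := by simp [hu, hf0]
  intro x hx
  rcases eq_or_ne x 0 with rfl | hx0
  · simp [h0p, h0m, hu0]
  rcases (mem_closedBall_zero_iff.1 hx).lt_or_eq with hx1 | hx1
  · have hxpos : 0 < ‖x‖ := norm_pos_iff.2 hx0
    obtain ⟨θ, hθ, hxθ⟩ : ∃ θ ∈ Icc 0 (2 * Real.pi), logPolar (Real.log ‖x‖) θ = x := by
      have h := Complex.norm_mul_exp_arg_mul_I x
      rcases le_or_gt 0 (Complex.arg x) with h0 | h0
      · refine ⟨Complex.arg x, ⟨h0, ?_⟩, ?_⟩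
        · linarith [Complex.arg_le_pi x, Real.pi_pos]
        · rw [logPolar_eq, Real.exp_log hxpos, h]
      · refine ⟨Complex.arg x + 2 * Real.pi, ⟨?_, ?_⟩, ?_⟩
        · linarith [Complex.neg_pi_lt_arg x, Real.pi_pos]
        · linarith
        · rw [logPolar_eq, Real.exp_log hxpos]
          push_cast
          rw [add_mul, Complex.exp_add, Complex.exp_two_pi_mul_I, mul_one, h]
    have ht : Real.log ‖x‖ < 0 := Real.log_neg hxpos hx1
    obtain ⟨h1, h2⟩ := hΨ.renormalized_eq hlam hβ hf1 hfpos hu' hu0 huC2 huSol h0p h0m ht hθ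
    have h3 := hu' (Real.log ‖x‖) θ
    rw [hxθ] at h1 h2 h3
    have hφ : (f (Real.exp (Real.log ‖x‖)) : ℂ) ≠ 0 := by
      rw [Real.exp_log hxpos]
      exact_mod_cast (hfpos _ ⟨hxpos, hx1.le⟩).1.ne'
    have hs : (Real.sqrt 2 : ℂ) ≠ 0 := by
      exact_mod_cast (Real.sqrt_pos.2 two_pos).ne'
    constructor
    · rw [h3, ← h1, Complex.real_smul]
      push_cast
      field_simp
    · rw [h3, ← h2, Complex.real_smul]
      push_cast
      field_simp
  · rw [hub x hx1]
    exact hΨ.2.2.2.2.2 x hx1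
end
end

section
/- Let b₀ ∈ ℝ and set ρ := min(1/2, 1/(2|b₀|)) (with ρ = 1/2 when b₀ = 0). For every b ∈ ℝ with |b − b₀| ≤ ρ there exists exactly one continuous function h:[0,ρ]→ℝ satisfying |h(r) − b₀| ≤ 1 for all r ∈ [0,ρ] and h(r) = b + (1/2)·∫₀^r (s²/r² − 1)·s·(1 − s²·h(s)²)·h(s) ds for all r ∈ (0,ρ]. Setting φ(r) := r·h(r), the function φ is C² on (0,ρ) and solves −φ''(r) − φ'(r)/r + φ(r)/r² = (1 − φ(r)²)·φ(r) on (0,ρ), with φ(0)=0 and φ(r)/r → b as r → 0⁺. Moreover, the map (r,b) ↦ φ(r,b) is jointly real-analytic on (−ρ,ρ) × (b₀−ρ, b₀+ρ). -/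
open MeasureTheory Metric Set Filter

noncomputable section

/-- `h` is a solution of the fixed-point integral equation for the shooting problem with
parameter `b`, on the interval `[0, ρ]`, staying within distance `1` of `b₀`. -/
def SolH (b₀ ρ b : ℝ) (h : ℝ → ℝ) : Prop :=
  ContinuousOn h (Icc 0 ρ) ∧ (∀ r ∈ Icc (0 : ℝ) ρ, |h r - b₀| ≤ 1) ∧
  ∀ r ∈ Ioc (0 : ℝ) ρ,
    h r = b + (1 / 2) * ∫ s in (0 : ℝ)..r, (s ^ 2 / r ^ 2 - 1) * s * (1 - s ^ 2 * (h s) ^ 2) * h s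

open scoped Topology ContDiff unitInterval

/-- A fixed point of an analytic family of locally contracting maps depends analytically on
the parameter. -/
theorem exists_analyticAt_fixedPoint {E X : Type*} [NormedAddCommGroup E] [NormedSpace ℝ E]
    [CompleteSpace E] [NormedAddCommGroup X] [NormedSpace ℝ X] [CompleteSpace X]
    {P : E × X → X} {x₀ : E} {u₀ : X} (hP : ContDiffAt ℝ ω P (x₀, u₀)) (hfix : P (x₀, u₀) = u₀)
    {K : NNReal} (hK : K < 1) {s : Set X} (hs : s ∈ 𝓝 u₀)
    (hlip : LipschitzOnWith K (fun u => P (x₀, u)) s) :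
    ∃ ψ : E → X, AnalyticAt ℝ ψ x₀ ∧ ψ x₀ = u₀ ∧ ∀ᶠ x in 𝓝 x₀, P (x, ψ x) = ψ x := by
  have hω : (ω : WithTop ℕ∞) ≠ 0 := by simp
  have hPd : HasFDerivAt P (fderiv ℝ P (x₀, u₀)) (x₀, u₀) :=
    (hP.differentiableAt hω).hasFDerivAt
  have hG : ContDiffAt ℝ ω (fun p : E × X => p.2 - P p) (x₀, u₀) := contDiffAt_snd.sub hP
  have hT : HasFDerivAt (fun u => P (x₀, u)) (fderiv ℝ P (x₀, u₀) ∘L .inr ℝ E X) u₀ :=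
    hPd.comp u₀ (hasFDerivAt_prodMk_right x₀ u₀)
  have hTn : ‖fderiv ℝ P (x₀, u₀) ∘L .inr ℝ E X‖ < 1 :=
    (hT.le_of_lipschitzOn hs hlip).trans_lt (by exact_mod_cast hK)
  have hGd : fderiv ℝ (fun p : E × X => p.2 - P p) (x₀, u₀) ∘L .inr ℝ E X
      = 1 - fderiv ℝ P (x₀, u₀) ∘L .inr ℝ E X := by
    rw [(hasFDerivAt_snd.fun_sub hPd).fderiv]
    ext u
    simp
  have hinv : (fderiv ℝ (fun p : E × X => p.2 - P p) (x₀, u₀) ∘L .inr ℝ E X).IsInvertible := by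
    rw [hGd]
    exact ⟨ContinuousLinearEquiv.unitsEquiv ℝ X (Units.oneSub _ hTn), rfl⟩
  refine ⟨hG.implicitFunction hω hinv, ?_, hG.implicitFunction_apply_self hω hinv, ?_⟩
  · exact (hG.contDiffAt_implicitFunction hω hinv).analyticAt
  · filter_upwards [hG.eventually_apply_implicitFunction hω hinv] with x hx
    rw [hfix, sub_self] at hx
    exact (sub_eq_zero.mp hx).symm

/-- The rescaled integral operator `v ↦ (t²/2) ∫₀¹ (τ² - 1) τ v(tτ) dτ` on `C([0,1])`. -/
def radialOp : C(I, ℝ) →L[ℝ] C(I, ℝ) :=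
  LinearMap.mkContinuous
    { toFun := fun v =>
        ⟨fun t => (1 / 2) * (t : ℝ) ^ 2 *
          ∫ τ in (0 : ℝ)..1, (τ ^ 2 - 1) * τ * IccExtend zero_le_one v (t * τ), by
          have := v.continuous.Icc_extend' (h := zero_le_one (α := ℝ))
          fun_prop⟩
      map_add' := fun v w => by
        have hv := v.continuous.Icc_extend' (h := zero_le_one (α := ℝ))
        have hw := w.continuous.Icc_extend' (h := zero_le_one (α := ℝ))
        ext t
        simp only [ContinuousMap.coe_mk, ContinuousMap.add_apply]
        rw [← mul_add, ← intervalIntegral.integral_add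
          (Continuous.intervalIntegrable (by fun_prop) _ _)
          (Continuous.intervalIntegrable (by fun_prop) _ _)]
        simp [IccExtend, mul_add]
      map_smul' := fun c v => by
        ext t
        simp only [ContinuousMap.coe_mk, ContinuousMap.smul_apply, smul_eq_mul, RingHom.id_apply]
        simp only [← intervalIntegral.integral_const_mul, IccExtend, Function.comp_apply,
          ContinuousMap.smul_apply, smul_eq_mul]
        congr 1 with τ
        ring }
    (1 / 2) fun v => by
      rw [ContinuousMap.norm_le _ (by positivity)]
      intro t
      have hint : ‖∫ τ in (0 : ℝ)..1, (τ ^ 2 - 1) * τ * IccExtend zero_le_one v (t * τ)‖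
          ≤ ‖v‖ * |1 - 0| := by
        refine intervalIntegral.norm_integral_le_of_norm_le_const fun τ hτ => ?_
        rw [uIoc_of_le zero_le_one] at hτ
        have h1 : |(τ ^ 2 - 1) * τ| ≤ 1 := by
          rw [abs_le]; constructor <;> nlinarith [hτ.1, hτ.2, mul_pos hτ.1 hτ.1]
        have h2 : ‖IccExtend zero_le_one v (t * τ)‖ ≤ ‖v‖ := v.norm_coe_le_norm _
        rw [norm_mul, Real.norm_eq_abs]
        nlinarith [abs_nonneg ((τ ^ 2 - 1) * τ), norm_nonneg v]
      have ht : (t : ℝ) ^ 2 ≤ 1 := pow_le_one₀ t.2.1 t.2.2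
      simp only [LinearMap.coe_mk, AddHom.coe_mk, ContinuousMap.coe_mk]
      rw [norm_mul, Real.norm_of_nonneg (by positivity)]
      rw [sub_zero, abs_one, mul_one] at hint
      calc _ ≤ 1 / 2 * 1 * ‖v‖ := by gcongr
        _ = _ := by ring

theorem radialOp_apply (v : C(I, ℝ)) (t : I) :
    radialOp v t = (1 / 2) * (t : ℝ) ^ 2 *
      ∫ τ in (0 : ℝ)..1, (τ ^ 2 - 1) * τ * IccExtend zero_le_one v (t * τ) := rfl

theorem norm_radialOp_le (v : C(I, ℝ)) : ‖radialOp v‖ ≤ 1 / 2 * ‖v‖ :=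
  LinearMap.mkContinuous_norm_le _ (by norm_num) _ |> radialOp.le_of_opNorm_le <| v

/-- The function `t ↦ t²` on the unit interval. -/
def sqI : C(I, ℝ) := ⟨fun t => (t : ℝ) ^ 2, by fun_prop⟩

/-- The Picard map of the equation satisfied by `t ↦ h (R t)`, with parameters `(R, b)`. -/
def picard (p : (ℝ × ℝ) × C(I, ℝ)) : C(I, ℝ) :=
  p.1.2 • 1 + p.1.1 ^ 2 • radialOp (p.2 - p.1.1 ^ 2 • (sqI * p.2 ^ 3))

theorem contDiff_picard : ContDiff ℝ ω picard := by
  unfold picard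
  fun_prop

theorem mem_closedBall_smul_one_iff {b₀ ε : ℝ} (hε : 0 ≤ ε) {u : C(I, ℝ)} :
    u ∈ closedBall (b₀ • (1 : C(I, ℝ))) ε ↔ ∀ t, |u t - b₀| ≤ ε := by
  rw [mem_closedBall, ContinuousMap.dist_le hε]
  simp [Real.dist_eq]

/-- Condition on the parameters under which the Picard map is a contraction. -/
structure Admissible (b₀ ρ : ℝ) : Prop where
  pos : 0 < ρ
  le_half : ρ ≤ 1 / 2
  mul_le : ρ * |b₀| ≤ 1 / 2

namespace Admissible

variable {b₀ ρ R b : ℝ}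

theorem abs_mul_le (hρ : Admissible b₀ ρ) (hR : |R| ≤ ρ) {x t : ℝ} (hx : |x - b₀| ≤ 1)
    (ht : t ∈ Icc (0 : ℝ) 1) : |R * t * x| ≤ 1 := by
  have hx' : |x| ≤ |b₀| + 1 := by
    have := abs_sub_abs_le_abs_sub x b₀
    linarith
  rw [abs_mul, abs_mul, abs_of_nonneg ht.1]
  calc |R| * t * |x| ≤ ρ * 1 * (|b₀| + 1) := by
        have := hρ.pos.le
        have := ht.1
        have := ht.2
        gcongr
    _ ≤ 1 := by linarith [hρ.mul_le, hρ.le_half]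

theorem norm_nonlin_sub_le (hρ : Admissible b₀ ρ) (hR : |R| ≤ ρ) {u v : C(I, ℝ)}
    (hu : u ∈ closedBall (b₀ • (1 : C(I, ℝ))) 1) (hv : v ∈ closedBall (b₀ • (1 : C(I, ℝ))) 1) :
    ‖(u - R ^ 2 • (sqI * u ^ 3)) - (v - R ^ 2 • (sqI * v ^ 3))‖ ≤ 2 * ‖u - v‖ := by
  rw [mem_closedBall_smul_one_iff zero_le_one] at hu hv
  rw [ContinuousMap.norm_le _ (by positivity)]
  intro t
  have hx := abs_le.mp (hρ.abs_mul_le hR (hu t) t.2)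
  have hy := abs_le.mp (hρ.abs_mul_le hR (hv t) t.2)
  have hfac : ((u - R ^ 2 • (sqI * u ^ 3)) - (v - R ^ 2 • (sqI * v ^ 3))) t
      = (1 - ((R * t * u t) ^ 2 + (R * t * u t) * (R * t * v t) + (R * t * v t) ^ 2))
        * (u - v) t := by
    simp [sqI]
    ring
  rw [hfac, norm_mul]
  gcongr
  · rw [Real.norm_eq_abs]
    generalize R * t * u t = x at hx
    generalize R * t * v t = y at hy
    rw [abs_le]
    constructor <;> nlinarith [sq_nonneg (x + y), sq_nonneg (x - y), hx.1, hx.2, hy.1, hy.2]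
  · exact (u - v).norm_coe_le_norm t

theorem sq_le (hρ : Admissible b₀ ρ) (hR : |R| ≤ ρ) : R ^ 2 ≤ 1 / 4 := by
  have := hρ.le_half
  nlinarith [sq_abs R, abs_nonneg R]

theorem lipschitzOnWith_picard (hρ : Admissible b₀ ρ) (hR : |R| ≤ ρ) :
    LipschitzOnWith (1 / 2) (fun u => picard ((R, b), u))
      (closedBall (b₀ • (1 : C(I, ℝ))) 1) := by
  refine LipschitzOnWith.of_dist_le_mul fun u hu v hv => ?_
  rw [dist_eq_norm, dist_eq_norm]
  simp only [picard]
  rw [add_sub_add_left_eq_sub, ← smul_sub, ← map_sub, norm_smul, norm_pow, Real.norm_eq_abs,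
    sq_abs]
  have h1 := norm_radialOp_le ((u - R ^ 2 • (sqI * u ^ 3)) - (v - R ^ 2 • (sqI * v ^ 3)))
  have h2 := hρ.norm_nonlin_sub_le hR hu hv
  have h3 := hρ.sq_le hR
  have h4 : (((1 / 2 : NNReal)) : ℝ) = 1 / 2 := by norm_num
  rw [h4]
  calc _ ≤ 1 / 4 * (1 / 2 * (2 * ‖u - v‖)) := by gcongr; linarith
    _ ≤ _ := by linarith [norm_nonneg (u - v)]

theorem norm_nonlin_le (hρ : Admissible b₀ ρ) (hR : |R| ≤ ρ) {u : C(I, ℝ)}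
    (hu : u ∈ closedBall (b₀ • (1 : C(I, ℝ))) 1) :
    ‖u - R ^ 2 • (sqI * u ^ 3)‖ ≤ |b₀| + 1 := by
  rw [mem_closedBall_smul_one_iff zero_le_one] at hu
  rw [ContinuousMap.norm_le _ (by positivity)]
  intro t
  have hx := abs_le.mp (hρ.abs_mul_le hR (hu t) t.2)
  have hut : |u t| ≤ |b₀| + 1 := by
    have := abs_sub_abs_le_abs_sub (u t) b₀
    linarith [hu t]
  have hfac : (u - R ^ 2 • (sqI * u ^ 3)) t = (1 - (R * t * u t) ^ 2) * u t := by
    simp [sqI]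
    ring
  rw [hfac, norm_mul]
  have h1 : ‖1 - (R * t * u t) ^ 2‖ ≤ 1 := by
    rw [Real.norm_eq_abs, abs_le]
    constructor <;> nlinarith
  calc _ ≤ 1 * |u t| := by gcongr; exact le_rfl
    _ ≤ _ := by linarith

theorem picard_mem (hρ : Admissible b₀ ρ) (hR : |R| ≤ ρ) (hb : |b - b₀| ≤ ρ) {u : C(I, ℝ)}
    (hu : u ∈ closedBall (b₀ • (1 : C(I, ℝ))) 1) :
    picard ((R, b), u) ∈ ball (b₀ • (1 : C(I, ℝ))) 1 := by
  have hsplit : picard ((R, b), u) - b₀ • 1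
      = (b - b₀) • 1 + R ^ 2 • radialOp (u - R ^ 2 • (sqI * u ^ 3)) := by
    simp only [picard, sub_smul]
    abel
  rw [mem_ball, dist_eq_norm, hsplit]
  refine (norm_add_le _ _).trans_lt ?_
  rw [norm_smul, norm_one, mul_one, norm_smul, norm_pow, Real.norm_eq_abs, Real.norm_eq_abs]
  have h1 := (norm_radialOp_le _).trans
    (mul_le_mul_of_nonneg_left (hρ.norm_nonlin_le hR hu) (by norm_num : (0 : ℝ) ≤ 1 / 2))
  have h2 : |R| ^ 2 ≤ ρ * (1 / 2) := by
    nlinarith [abs_nonneg R, hρ.le_half, hρ.pos]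
  have h3 : |R| ^ 2 * ‖radialOp (u - R ^ 2 • (sqI * u ^ 3))‖
      ≤ ρ * (1 / 2) * (1 / 2 * (|b₀| + 1)) := by
    have := hρ.pos.le
    gcongr
  nlinarith [hρ.mul_le, hρ.le_half]

theorem exists_fixedPoint (hρ : Admissible b₀ ρ) (hR : |R| ≤ ρ) (hb : |b - b₀| ≤ ρ) :
    ∃ u ∈ closedBall (b₀ • (1 : C(I, ℝ))) 1, picard ((R, b), u) = u := by
  have hmaps : MapsTo (fun u => picard ((R, b), u)) (closedBall (b₀ • (1 : C(I, ℝ))) 1)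
      (closedBall (b₀ • (1 : C(I, ℝ))) 1) :=
    fun u hu => ball_subset_closedBall (hρ.picard_mem hR hb hu)
  have hcontr : ContractingWith (1 / 2) (hmaps.restrict _ _ _) :=
    ⟨by norm_num, (hρ.lipschitzOnWith_picard hR).mapsToRestrict hmaps⟩
  obtain ⟨u, hu, hfix, -⟩ := hcontr.exists_fixedPoint' isClosed_closedBall.isComplete hmaps
    (mem_closedBall_self zero_le_one) (edist_ne_top _ _)
  exact ⟨u, hu, hfix⟩

theorem fixedPoint_unique (hρ : Admissible b₀ ρ) (hR : |R| ≤ ρ) {u v : C(I, ℝ)}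
    (hu : u ∈ closedBall (b₀ • (1 : C(I, ℝ))) 1) (hv : v ∈ closedBall (b₀ • (1 : C(I, ℝ))) 1)
    (hfu : picard ((R, b), u) = u) (hfv : picard ((R, b), v) = v) : u = v := by
  have h := (hρ.lipschitzOnWith_picard (b := b) hR).dist_le_mul u hu v hv
  simp only [hfu, hfv] at h
  have h4 : (((1 / 2 : NNReal)) : ℝ) = 1 / 2 := by norm_num
  rw [h4] at h
  exact dist_le_zero.mp (by linarith)

theorem exists_analytic_solution (hρ : Admissible b₀ ρ) :
    ∃ U : ℝ × ℝ → C(I, ℝ), AnalyticOnNhd ℝ U (Ioo (-ρ) ρ ×ˢ Ioo (b₀ - ρ) (b₀ + ρ)) ∧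
      ∀ p ∈ Ioo (-ρ) ρ ×ˢ Ioo (b₀ - ρ) (b₀ + ρ), ∀ u ∈ closedBall (b₀ • (1 : C(I, ℝ))) 1,
        picard (p, u) = u → U p = u := by
  set D := Ioo (-ρ) ρ ×ˢ Ioo (b₀ - ρ) (b₀ + ρ)
  have hDR : ∀ p ∈ D, |p.1| ≤ ρ := fun p hp => (abs_lt.mpr hp.1).le
  have hDb : ∀ p ∈ D, |p.2 - b₀| ≤ ρ := fun p hp =>
    abs_le.mpr ⟨by linarith [hp.2.1], by linarith [hp.2.2]⟩
  have hex : ∀ p, ∃ u, p ∈ D → u ∈ closedBall (b₀ • (1 : C(I, ℝ))) 1 ∧ picard (p, u) = u := by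
    intro p
    by_cases hp : p ∈ D
    · obtain ⟨u, hu⟩ := hρ.exists_fixedPoint (hDR p hp) (hDb p hp)
      exact ⟨u, fun _ => hu⟩
    · exact ⟨0, fun h => absurd h hp⟩
  choose U hU using hex
  refine ⟨U, fun p hp => ?_, fun p hp u hu hfix =>
    hρ.fixedPoint_unique (hDR p hp) (hU p hp).1 hu (hU p hp).2 hfix⟩
  have hball : U p ∈ ball (b₀ • (1 : C(I, ℝ))) 1 := by
    have := hρ.picard_mem (hDR p hp) (hDb p hp) (hU p hp).1
    rwa [(hU p hp).2] at this
  have hnhds := isOpen_ball.mem_nhds hball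
  obtain ⟨ψ, hψ, hψp, hψfix⟩ := exists_analyticAt_fixedPoint contDiff_picard.contDiffAt
    (hU p hp).2 (by norm_num : (1 / 2 : NNReal) < 1)
    (Filter.mem_of_superset hnhds ball_subset_closedBall) (hρ.lipschitzOnWith_picard (hDR p hp))
  refine hψ.congr ?_
  filter_upwards [hψfix, (isOpen_Ioo.prod isOpen_Ioo).mem_nhds hp,
    hψ.continuousAt.eventually_mem (hψp.symm ▸ hnhds)] with x hx hxD hxball
  exact hρ.fixedPoint_unique (hDR x hxD) (ball_subset_closedBall hxball) (hU x hxD).1 hx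
    (hU x hxD).2

end Admissible

theorem picard_apply_zero (R b : ℝ) (u : C(I, ℝ)) : picard ((R, b), u) 0 = b := by
  simp [picard, radialOp_apply]

theorem picard_apply_of_rescaled {R b : ℝ} (hR : 0 < R) {u : C(I, ℝ)} {h : ℝ → ℝ}
    (hu : ∀ t : I, u t = h (R * t)) {t : I} (ht : 0 < (t : ℝ)) :
    picard ((R, b), u) t = b + (1 / 2) * ∫ s in (0 : ℝ)..(R * t),
      (s ^ 2 / (R * t) ^ 2 - 1) * s * (1 - s ^ 2 * (h s) ^ 2) * h s := by
  have hr : R * t ≠ 0 := (mul_pos hR ht).ne'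
  have hsub := intervalIntegral.smul_integral_comp_mul_left (a := 0) (b := 1)
    (fun s => (s ^ 2 / (R * t) ^ 2 - 1) * s * (1 - s ^ 2 * (h s) ^ 2) * h s) (R * (t : ℝ))
  rw [mul_zero, mul_one] at hsub
  rw [← hsub]
  simp only [picard, ContinuousMap.add_apply, ContinuousMap.smul_apply, ContinuousMap.one_apply,
    smul_eq_mul, mul_one, radialOp_apply]
  have hcongr : ∫ τ in (0 : ℝ)..1, (τ ^ 2 - 1) * τ *
        IccExtend zero_le_one (u - R ^ 2 • (sqI * u ^ 3) : C(I, ℝ)) (t * τ)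
      = ∫ τ in (0 : ℝ)..1, (R * t)⁻¹ * (((R * t * τ) ^ 2 / (R * t) ^ 2 - 1) * (R * t * τ) *
          (1 - (R * t * τ) ^ 2 * (h (R * t * τ)) ^ 2) * h (R * t * τ)) := by
    refine intervalIntegral.integral_congr fun τ hτ => ?_
    rw [uIcc_of_le zero_le_one] at hτ
    have hmem : (t : ℝ) * τ ∈ Icc (0 : ℝ) 1 :=
      ⟨mul_nonneg t.2.1 hτ.1, mul_le_one₀ t.2.2 hτ.1 hτ.2⟩
    simp only [IccExtend_of_mem _ _ hmem, ContinuousMap.sub_apply, ContinuousMap.smul_apply,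
      ContinuousMap.mul_apply, ContinuousMap.pow_apply, hu, sqI, ContinuousMap.coe_mk,
      smul_eq_mul, ← mul_assoc]
    field_simp
  rw [hcongr, intervalIntegral.integral_const_mul]
  field_simp

namespace SolH

variable {b₀ ρ R b : ℝ} {h : ℝ → ℝ}

theorem exists_rescaled (hh : SolH b₀ ρ b h) (hR : R ∈ Ioc 0 ρ) :
    ∃ u ∈ closedBall (b₀ • (1 : C(I, ℝ))) 1,
      picard ((R, b), u) = u ∧ ∀ t : I, u t = h (R * t) := by
  obtain ⟨hcont, hbd, heq⟩ := hh
  have hmem : ∀ t : I, R * (t : ℝ) ∈ Icc 0 ρ := fun t =>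
    ⟨mul_nonneg hR.1.le t.2.1, (mul_le_of_le_one_right hR.1.le t.2.2).trans hR.2⟩
  let u : C(I, ℝ) := ⟨fun t => h (R * t), hcont.comp_continuous (by fun_prop) hmem⟩
  refine ⟨u, (mem_closedBall_smul_one_iff zero_le_one).mpr fun t => hbd _ (hmem t), ?_,
    fun _ => rfl⟩
  refine DFunLike.coe_injective <| (picard ((R, b), u)).continuous.ext_on
    (dense_compl_singleton (0 : I)) u.continuous fun t ht => ?_
  have ht0 : 0 < (t : ℝ) := unitInterval.pos_iff_ne_zero.mpr ht
  have hpos : 0 < R * (t : ℝ) := mul_pos hR.1 ht0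
  rw [picard_apply_of_rescaled hR.1 (fun _ => rfl) ht0]
  exact (heq _ ⟨hpos, (hmem t).2⟩).symm

theorem of_fixedPoint (hρ : 0 < ρ) {u : C(I, ℝ)}
    (hu : u ∈ closedBall (b₀ • (1 : C(I, ℝ))) 1) (hfix : picard ((ρ, b), u) = u) :
    SolH b₀ ρ b (fun s => IccExtend zero_le_one u (s / ρ)) := by
  rw [mem_closedBall_smul_one_iff zero_le_one] at hu
  refine ⟨Continuous.continuousOn ?_, fun r _ => hu _, fun r hr => ?_⟩
  · have := u.continuous.Icc_extend' (h := zero_le_one (α := ℝ))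
    fun_prop
  · have hmem : r / ρ ∈ Icc (0 : ℝ) 1 :=
      ⟨div_nonneg hr.1.le hρ.le, (div_le_one hρ).mpr hr.2⟩
    have := picard_apply_of_rescaled (b := b) hρ (u := u)
      (h := fun s => IccExtend zero_le_one u (s / ρ))
      (fun t => by simp [mul_div_cancel_left₀ _ hρ.ne'])
      (t := ⟨r / ρ, hmem⟩) (div_pos hr.1 hρ)
    rw [hfix] at this
    simp only [mul_div_cancel₀ r hρ.ne'] at this
    exact (IccExtend_of_mem _ _ hmem).trans this

theorem eqOn (hρ : Admissible b₀ ρ) {h₁ h₂ : ℝ → ℝ}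
    (hh₁ : SolH b₀ ρ b h₁) (hh₂ : SolH b₀ ρ b h₂) : EqOn h₁ h₂ (Icc 0 ρ) := by
  intro r hr
  obtain ⟨u, hu, hfu, hu'⟩ := hh₁.exists_rescaled (right_mem_Ioc.mpr hρ.pos)
  obtain ⟨v, hv, hfv, hv'⟩ := hh₂.exists_rescaled (right_mem_Ioc.mpr hρ.pos)
  have huv := hρ.fixedPoint_unique (abs_of_pos hρ.pos).le hu hv hfu hfv
  have hmem : r / ρ ∈ Icc (0 : ℝ) 1 :=
    ⟨div_nonneg hr.1 hρ.pos.le, (div_le_one hρ.pos).mpr hr.2⟩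
  have h1 := hu' ⟨r / ρ, hmem⟩
  have h2 := hv' ⟨r / ρ, hmem⟩
  simp only [mul_div_cancel₀ r hρ.pos.ne'] at h1 h2
  rw [← h1, ← h2, huv]

theorem apply_zero (hρ : 0 < ρ) (hh : SolH b₀ ρ b h) : h 0 = b := by
  obtain ⟨u, -, hfix, hu⟩ := hh.exists_rescaled (right_mem_Ioc.mpr hρ)
  have h0 := hu 0
  rw [← hfix, picard_apply_zero] at h0
  simpa using h0.symm

theorem tendsto (hρ : 0 < ρ) (hh : SolH b₀ ρ b h) :
    Tendsto (fun r => (r * h r) / r) (𝓝[>] 0) (𝓝 b) := by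
  have hc := (hh.1 0 (left_mem_Icc.mpr hρ.le)).tendsto
  rw [hh.apply_zero hρ] at hc
  have hle : 𝓝[>] (0 : ℝ) ≤ 𝓝[Icc 0 ρ] 0 := by
    rw [← nhdsWithin_Ioc_eq_nhdsGT hρ]
    exact nhdsWithin_mono _ Ioc_subset_Icc_self
  refine (hc.mono_left hle).congr' ?_
  filter_upwards [self_mem_nhdsWithin] with r hr
  exact (mul_div_cancel_left₀ _ (ne_of_gt hr)).symm

/-- The function `r ↦ r h(r)` has two derivatives on `(0, ρ)`, the second one continuous, and
they satisfy the differential equation. -/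
theorem exists_hasDerivAt (hρ : 0 < ρ) (hh : SolH b₀ ρ b h) :
    ∃ f₁ f₂ : ℝ → ℝ, ContinuousOn f₂ (Ioo 0 ρ) ∧
      (∀ r ∈ Ioo 0 ρ, HasDerivAt (fun t => t * h t) (f₁ r) r) ∧
      (∀ r ∈ Ioo 0 ρ, HasDerivAt f₁ (f₂ r) r) ∧
      ∀ r ∈ Ioo 0 ρ, -f₂ r - f₁ r / r + (r * h r) / r ^ 2 = (1 - (r * h r) ^ 2) * (r * h r) := by
  set H : ℝ → ℝ := IccExtend hρ.le ((Icc 0 ρ).domRestrict h) with hH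
  have hHc : Continuous H := hh.1.domRestrict.Icc_extend'
  have hHh : ∀ r ∈ Icc 0 ρ, H r = h r := fun r hr => IccExtend_of_mem _ _ hr
  set G : ℝ → ℝ := fun s => (1 - s ^ 2 * (H s) ^ 2) * H s with hG
  have hGc : Continuous G := by fun_prop
  set A : ℝ → ℝ := fun r => ∫ s in (0 : ℝ)..r, s ^ 3 * G s with hA
  set B : ℝ → ℝ := fun r => ∫ s in (0 : ℝ)..r, s * G s with hB
  have hAd : ∀ r, HasDerivAt A (r ^ 3 * G r) r := fun r =>
    (by fun_prop : Continuous fun s => s ^ 3 * G s).integral_hasStrictDerivAt 0 r |>.hasDerivAt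
  have hBd : ∀ r, HasDerivAt B (r * G r) r := fun r =>
    (by fun_prop : Continuous fun s => s * G s).integral_hasStrictDerivAt 0 r |>.hasDerivAt
  have hAc : Continuous A := continuous_iff_continuousAt.mpr fun r => (hAd r).continuousAt
  have hφ : ∀ r ∈ Ioo 0 ρ, r * h r = r * b + (1 / 2) * (A r / r - r * B r) := by
    intro r hr
    have hr0 : r ≠ 0 := hr.1.ne'
    have hint : ∫ s in (0 : ℝ)..r, (s ^ 2 / r ^ 2 - 1) * s * (1 - s ^ 2 * (h s) ^ 2) * h s
        = (r ^ 2)⁻¹ * A r - B r := by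
      rw [hA, hB, ← intervalIntegral.integral_const_mul, ← intervalIntegral.integral_sub
        (Continuous.intervalIntegrable (by fun_prop) _ _)
        (Continuous.intervalIntegrable (by fun_prop) _ _)]
      refine intervalIntegral.integral_congr fun s hs => ?_
      rw [uIcc_of_le hr.1.le] at hs
      simp only [hG, hHh s ⟨hs.1, hs.2.trans hr.2.le⟩]
      ring
    rw [hh.2.2 r ⟨hr.1, hr.2.le⟩, hint]
    field_simp
  refine ⟨fun r => b + (1 / 2) * (-(A r / r ^ 2) - B r), fun r => A r / r ^ 3 - r * G r,
    ?_, fun r hr => ?_, fun r hr => ?_, fun r hr => ?_⟩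
  · exact (hAc.continuousOn.div (by fun_prop) fun r hr => pow_ne_zero _ hr.1.ne').sub
      (by fun_prop)
  · have hr0 : r ≠ 0 := hr.1.ne'
    have hd := ((hasDerivAt_id r).mul_const b).add
      ((((hAd r).div (hasDerivAt_id r) hr0).sub ((hasDerivAt_id r).mul (hBd r))).const_mul (1 / 2))
    refine (hd.congr_deriv ?_).congr_of_eventuallyEq ?_
    · simp only [id]
      field_simp
      ring
    · filter_upwards [isOpen_Ioo.mem_nhds hr] with t ht using hφ t ht
  · have hr0 : r ≠ 0 := hr.1.ne'
    have hd := ((((hAd r).div (hasDerivAt_pow 2 r) (pow_ne_zero 2 hr0)).neg.sub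
      (hBd r)).const_mul (1 / 2)).const_add b
    refine hd.congr_deriv ?_
    field_simp
    ring
  · have hr0 : r ≠ 0 := hr.1.ne'
    have hGr : (1 - (r * h r) ^ 2) * (r * h r) = r * G r := by
      simp only [hG, hHh r ⟨hr.1.le, hr.2.le⟩]
      ring
    rw [hGr, hφ r hr]
    field_simp
    ring

theorem contDiffOn_and_ode (hρ : 0 < ρ) (hh : SolH b₀ ρ b h) :
    ContDiffOn ℝ 2 (fun r => r * h r) (Ioo 0 ρ) ∧
      ∀ r ∈ Ioo (0 : ℝ) ρ,
        -(derivWithin (derivWithin (fun t => t * h t) (Ioo 0 ρ)) (Ioo 0 ρ) r)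
            - derivWithin (fun t => t * h t) (Ioo 0 ρ) r / r + (r * h r) / r ^ 2
          = (1 - (r * h r) ^ 2) * (r * h r) := by
  obtain ⟨f₁, f₂, hf₂, hd₁, hd₂, hode⟩ := hh.exists_hasDerivAt hρ
  have hU : UniqueDiffOn ℝ (Ioo 0 ρ) := uniqueDiffOn_Ioo 0 ρ
  have e₁ : EqOn (derivWithin (fun t => t * h t) (Ioo 0 ρ)) f₁ (Ioo 0 ρ) := fun r hr =>
    (hd₁ r hr).hasDerivWithinAt.derivWithin (hU r hr)
  have e₂ : EqOn (derivWithin f₁ (Ioo 0 ρ)) f₂ (Ioo 0 ρ) := fun r hr =>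
    (hd₂ r hr).hasDerivWithinAt.derivWithin (hU r hr)
  constructor
  · have hf₁ : ContDiffOn ℝ 1 f₁ (Ioo 0 ρ) := by
      rw [show (1 : WithTop ℕ∞) = 0 + 1 by simp, contDiffOn_succ_iff_derivWithin hU]
      exact ⟨fun r hr => (hd₂ r hr).differentiableAt.differentiableWithinAt, by simp,
        contDiffOn_zero.mpr (hf₂.congr e₂)⟩
    rw [show (2 : WithTop ℕ∞) = 1 + 1 by norm_num, contDiffOn_succ_iff_derivWithin hU]
    exact ⟨fun r hr => (hd₁ r hr).differentiableAt.differentiableWithinAt, by simp,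
      hf₁.congr e₁⟩
  · intro r hr
    rw [derivWithin_congr e₁ (e₁ hr), e₁ hr, e₂ hr]
    exact hode r hr

end SolH

theorem admissible_of_eq {b₀ ρ : ℝ}
    (hρ : ρ = if b₀ = 0 then 1 / 2 else min (1 / 2) (1 / (2 * |b₀|))) : Admissible b₀ ρ := by
  split_ifs at hρ with h0
  · subst hρ h0
    constructor <;> norm_num
  · have hb : 0 < |b₀| := abs_pos.mpr h0
    refine ⟨hρ ▸ lt_min (by norm_num) (by positivity), hρ ▸ min_le_left _ _, ?_⟩
    calc ρ * |b₀| ≤ 1 / (2 * |b₀|) * |b₀| := by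
          gcongr
          exact hρ ▸ min_le_right _ _
      _ = 1 / 2 := by field_simp

/-- Existence, uniqueness, regularity and joint analyticity for the singular Cauchy
problem `−φ'' − φ'/r + φ/r² = (1−φ²)φ`, `φ(0) = 0`, `φ'(0) = b`, via the fixed-point
equation for `h(r) = φ(r)/r`. -/
theorem statement16 (b₀ ρ : ℝ)
    (hρ : ρ = if b₀ = 0 then 1 / 2 else min (1 / 2) (1 / (2 * |b₀|))) :
    (∀ b : ℝ, |b - b₀| ≤ ρ →
      (∃ h : ℝ → ℝ, SolH b₀ ρ b h) ∧
      (∀ h₁ h₂ : ℝ → ℝ, SolH b₀ ρ b h₁ → SolH b₀ ρ b h₂ → EqOn h₁ h₂ (Icc 0 ρ)) ∧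
      (∀ h : ℝ → ℝ, SolH b₀ ρ b h →
        ContDiffOn ℝ 2 (fun r => r * h r) (Ioo 0 ρ) ∧
        (∀ r ∈ Ioo (0 : ℝ) ρ,
          -(derivWithin (derivWithin (fun t => t * h t) (Ioo 0 ρ)) (Ioo 0 ρ) r)
              - derivWithin (fun t => t * h t) (Ioo 0 ρ) r / r + (r * h r) / r ^ 2
            = (1 - (r * h r) ^ 2) * (r * h r)) ∧
        (0 : ℝ) * h 0 = 0 ∧
        Tendsto (fun r => (r * h r) / r) (nhdsWithin 0 (Ioi 0)) (nhds b))) ∧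
    (∃ Φ : ℝ × ℝ → ℝ,
      AnalyticOnNhd ℝ Φ (Ioo (-ρ) ρ ×ˢ Ioo (b₀ - ρ) (b₀ + ρ)) ∧
      ∀ b ∈ Ioo (b₀ - ρ) (b₀ + ρ), ∀ h : ℝ → ℝ, SolH b₀ ρ b h →
        ∀ r ∈ Ico (0 : ℝ) ρ, Φ (r, b) = r * h r) := by
  have hA := admissible_of_eq hρ
  refine ⟨fun b hb => ⟨?_, fun h₁ h₂ hh₁ hh₂ => SolH.eqOn hA hh₁ hh₂, fun h hh => ?_⟩, ?_⟩
  · obtain ⟨u, hu, hfix⟩ := hA.exists_fixedPoint (abs_of_pos hA.pos).le hb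
    exact ⟨_, SolH.of_fixedPoint hA.pos hu hfix⟩
  · obtain ⟨hreg, hode⟩ := hh.contDiffOn_and_ode hA.pos
    exact ⟨hreg, hode, zero_mul _, hh.tendsto hA.pos⟩
  · obtain ⟨U, hU, hUeq⟩ := hA.exists_analytic_solution
    refine ⟨fun p => p.1 * U p 1, fun p hp => ?_, fun b hb h hh r hr => ?_⟩
    · exact analyticAt_fst.mul
        (((ContinuousMap.evalCLM ℝ (1 : I)).analyticAt (U p)).comp (hU p hp) :)
    · rcases hr.1.eq_or_lt with rfl | hpos
      · simp
      · obtain ⟨u, hu, hfix, hur⟩ := hh.exists_rescaled ⟨hpos, hr.2.le⟩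
        have hmem : (r, b) ∈ Ioo (-ρ) ρ ×ˢ Ioo (b₀ - ρ) (b₀ + ρ) :=
          ⟨⟨by linarith [hA.pos], hr.2⟩, hb⟩
        simp [hUeq _ hmem u hu hfix, hur]
end
end

section
/- Let r₀ > 0 and let F:[0,r₀)→ℝ be continuous with F(0)=0, C² on (0,r₀), such that F and F' extend continuously to r=0, F solves −F''(r) − F'(r)/r + F(r)/r² = (1−F(r)²)·F(r) on (0,r₀), and 0 < F(r) < 1 for all r ∈ (0,r₀). Then: (a) F''(r) → 0 as r → 0⁺; (b) the function r ↦ F(r)/r is strictly decreasing on (0,r₀), i.e. (F(r)/r)' < 0 there; (c) 2·F(r)/r³ > F'(r)/r² for all r ∈ (0,r₀). -/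
open Set Filter

noncomputable section

/-- Properties of positive solutions `0 < F < 1` of the singular ODE
`−F'' − F'/r + F/r² = (1−F²)F` on `(0, r₀)` with `F(0) = 0`:
(a) `F''(r) → 0` as `r → 0⁺`; (b) `F(r)/r` is strictly decreasing on `(0, r₀)`,
with `(F(r)/r)' < 0` there; (c) `2F(r)/r³ > F'(r)/r²` on `(0, r₀)`. -/
theorem statement17 (r₀ : ℝ) (hr₀ : 0 < r₀) (F : ℝ → ℝ)
    (hF0 : F 0 = 0)
    (hcont : ContinuousOn F (Ico 0 r₀))
    (hC2 : ∀ r ∈ Ioo (0 : ℝ) r₀, ContDiffAt ℝ 2 F r)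
    (hF'ext : ∃ b : ℝ, Tendsto (deriv F) (nhdsWithin 0 (Ioi 0)) (nhds b))
    (hODE : ∀ r ∈ Ioo (0 : ℝ) r₀,
      -(deriv (deriv F) r) - deriv F r / r + F r / r ^ 2 = (1 - (F r) ^ 2) * F r)
    (hbound : ∀ r ∈ Ioo (0 : ℝ) r₀, 0 < F r ∧ F r < 1) :
    Tendsto (fun r => deriv (deriv F) r) (nhdsWithin 0 (Ioi 0)) (nhds 0) ∧
    StrictAntiOn (fun r => F r / r) (Ioo 0 r₀) ∧
    (∀ r ∈ Ioo (0 : ℝ) r₀, deriv (fun t => F t / t) r < 0) ∧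
    (∀ r ∈ Ioo (0 : ℝ) r₀, deriv F r / r ^ 2 < 2 * F r / r ^ 3) := by
  obtain ⟨b, hb⟩ := hF'ext
  have hFlim : Tendsto F (nhdsWithin 0 (Ioi 0)) (nhds 0) := by
    have h := (hcont 0 ⟨le_rfl, hr₀⟩).tendsto
    rw [hF0] at h
    exact h.mono_left (nhdsWithin_le_of_mem
      (mem_of_superset (Ioo_mem_nhdsGT hr₀) Ioo_subset_Ico_self))
  have hid : Tendsto (fun r : ℝ => r) (nhdsWithin 0 (Ioi 0)) (nhds 0) :=
    tendsto_id.mono_left nhdsWithin_le_nhds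
  have hF : ∀ r ∈ Ioo (0 : ℝ) r₀, HasDerivAt F (deriv F r) r := fun r hr =>
    ((hC2 r hr).differentiableAt (by norm_num)).hasDerivAt
  have hF' : ∀ r ∈ Ioo (0 : ℝ) r₀, HasDerivAt (deriv F) (deriv (deriv F) r) r := fun r hr =>
    ((((hC2 r hr).fderiv_right (m := 1) (by norm_num)).differentiableAt (by norm_num)).clm_apply
      (differentiableAt_const (1 : ℝ))).hasDerivAt
  -- The momentum `H = r² F' - r F` satisfies `H' = -r² (1 - F²) F`.
  set H : ℝ → ℝ := fun r => r ^ 2 * deriv F r - r * F r with hH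
  have hH' : ∀ r ∈ Ioo (0 : ℝ) r₀, HasDerivAt H (-(r ^ 2 * ((1 - F r ^ 2) * F r))) r := by
    intro r hr
    have hr0 : r ≠ 0 := hr.1.ne'
    refine ((((hasDerivAt_id r).pow 2).mul (hF' r hr)).sub
      ((hasDerivAt_id r).mul (hF r hr))).congr_deriv ?_
    rw [← hODE r hr]
    simp
    field_simp
    ring
  have hHlim : Tendsto H (nhdsWithin 0 (Ioi 0)) (nhds 0) := by
    simpa using ((hid.pow 2).mul hb).sub (hid.mul hFlim)
  have hanti : StrictAntiOn H (Ioo 0 r₀) := by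
    refine strictAntiOn_of_deriv_neg (convex_Ioo 0 r₀)
      (fun r hr => (hH' r hr).continuousAt.continuousWithinAt) fun r hr => ?_
    rw [interior_Ioo] at hr
    obtain ⟨h0, h1⟩ := hbound r hr
    have h2 : 0 < 1 - F r ^ 2 := by nlinarith
    have h3 := hr.1
    rw [(hH' r hr).deriv, neg_lt_zero]
    positivity
  have hneg : ∀ r ∈ Ioo (0 : ℝ) r₀, H r < 0 := by
    intro r hr
    have hm : r / 2 ∈ Ioo (0 : ℝ) r₀ := ⟨half_pos hr.1, (half_lt_self hr.1).trans hr.2⟩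
    refine (hanti hm hr (half_lt_self hr.1)).trans_le (ge_of_tendsto hHlim ?_)
    filter_upwards [Ioo_mem_nhdsGT hm.1] with s hs
    exact (hanti ⟨hs.1, hs.2.trans hm.2⟩ hm hs.2).le
  have hquot : ∀ r ∈ Ioo (0 : ℝ) r₀, deriv (fun t => F t / t) r < 0 := by
    intro r hr
    have h := hneg r hr
    have hd := (hF r hr).div (hasDerivAt_id r) hr.1.ne'
    have hr0 := hr.1
    simp only [hH] at h
    refine lt_of_eq_of_lt hd.deriv (div_neg_of_neg_of_pos ?_ (pow_pos hr0 2))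
    simp only [id]
    nlinarith
  have hcubic : Tendsto (fun r => H r / r ^ 3) (nhdsWithin 0 (Ioi 0)) (nhds 0) := by
    refine HasDerivAt.lhopital_zero_right_on_Ioo (g' := fun r => 3 * r ^ 2) hr₀ hH'
      (fun r _ => by simpa using hasDerivAt_pow 3 r)
      (fun r hr => by have := hr.1; positivity) hHlim (by simpa using hid.pow 3) ?_
    have hlim : Tendsto (fun r => -((1 - F r ^ 2) * F r) / 3) (nhdsWithin 0 (Ioi 0)) (nhds 0) := by
      simpa using ((((hFlim.pow 2).const_sub 1).mul hFlim).neg).div_const 3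
    refine hlim.congr' ?_
    filter_upwards [self_mem_nhdsWithin] with r hr
    have hr0 : r ≠ 0 := ne_of_gt hr
    field_simp
  refine ⟨?_, ?_, hquot, ?_⟩
  · have hlim : Tendsto (fun r => -(H r / r ^ 3) - (1 - F r ^ 2) * F r)
        (nhdsWithin 0 (Ioi 0)) (nhds 0) := by
      simpa using hcubic.neg.sub (((hFlim.pow 2).const_sub 1).mul hFlim)
    refine hlim.congr' ?_
    filter_upwards [Ioo_mem_nhdsGT hr₀] with r hr
    have hr0 : r ≠ 0 := hr.1.ne'
    rw [← hODE r hr]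
    simp only [hH]
    field_simp
    ring
  · refine strictAntiOn_of_deriv_neg (convex_Ioo 0 r₀) (fun r hr => ?_) (by simpa using hquot)
    exact ((hF r hr).continuousAt.div continuousAt_id hr.1.ne').continuousWithinAt
  · intro r hr
    have h := hneg r hr
    have hr0 := hr.1
    have hFr := (hbound r hr).1
    simp only [hH] at h
    rw [div_lt_div_iff₀ (by positivity) (by positivity)]
    have h1 : r * deriv F r < 2 * F r := by nlinarith
    nlinarith [mul_lt_mul_of_pos_left h1 (pow_pos hr0 2)]
end
end

section
/- Let R > 0 and let F:[0,R]→ℝ be continuous with F(0)=0 and F(R)=1, C² on (0,R), solving −F''(r) − F'(r)/r + F(r)/r² = (1−F(r)²)·F(r) on (0,R), and satisfying 0 < F(r) < 1 for all r ∈ (0,R). Then F is monotone nondecreasing on [0,R], i.e. F'(r) ≥ 0 for all r ∈ (0,R). -/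
open Set Filter

noncomputable section

/-- Necessary second-order condition at an interior local maximum. -/
theorem IsLocalMax.deriv_deriv_nonpos {f : ℝ → ℝ} {a : ℝ} (h : IsLocalMax f a)
    (hc : ContinuousAt f a) : deriv (deriv f) a ≤ 0 := by
  by_contra! hpos
  have hmin := isLocalMin_of_deriv_deriv_pos hpos h.deriv_eq_zero hc
  have heq : f =ᶠ[nhds a] fun _ => f a := by
    filter_upwards [h, hmin] with x h₁ h₂ using le_antisymm h₁ h₂
  have hzero : deriv (deriv f) a = 0 := by
    rw [heq.deriv.deriv_eq]
    simp
  exact hpos.ne' hzero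

/-- Necessary second-order condition at an interior local minimum. -/
theorem IsLocalMin.deriv_deriv_nonneg {f : ℝ → ℝ} {a : ℝ} (h : IsLocalMin f a)
    (hc : ContinuousAt f a) : 0 ≤ deriv (deriv f) a := by
  by_contra! hneg
  have hmax := isLocalMax_of_deriv_deriv_neg hneg h.deriv_eq_zero hc
  have heq : f =ᶠ[nhds a] fun _ => f a := by
    filter_upwards [h, hmax] with x h₁ h₂ using le_antisymm h₂ h₁
  have hzero : deriv (deriv f) a = 0 := by
    rw [heq.deriv.deriv_eq]
    simp
  exact hneg.ne hzero

/-- A solution of the singular ODE `−F'' − F'/r + F/r² = (1−F²)F` on `(0, R)` with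
`F(0) = 0`, `F(R) = 1` and `0 < F < 1` on `(0, R)` is monotone nondecreasing on `[0, R]`,
i.e. `F'(r) ≥ 0` for all `r ∈ (0, R)`. -/
theorem statement18 (R : ℝ) (hR : 0 < R) (F : ℝ → ℝ)
    (hF0 : F 0 = 0) (hFR : F R = 1)
    (hcont : ContinuousOn F (Icc 0 R))
    (hC2 : ∀ r ∈ Ioo (0 : ℝ) R, ContDiffAt ℝ 2 F r)
    (hODE : ∀ r ∈ Ioo (0 : ℝ) R,
      -(deriv (deriv F) r) - deriv F r / r + F r / r ^ 2 = (1 - (F r) ^ 2) * F r)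
    (hbound : ∀ r ∈ Ioo (0 : ℝ) R, 0 < F r ∧ F r < 1) :
    MonotoneOn F (Icc 0 R) ∧ ∀ r ∈ Ioo (0 : ℝ) R, 0 ≤ deriv F r := by
  have hrange : ∀ r ∈ Icc (0 : ℝ) R, 0 ≤ F r ∧ F r ≤ 1 := by
    intro r hr
    rcases hr.1.eq_or_lt with rfl | h0
    · simp [hF0]
    rcases hr.2.eq_or_lt with rfl | h1
    · simp [hFR]
    exact ⟨(hbound r ⟨h0, h1⟩).1.le, (hbound r ⟨h0, h1⟩).2.le⟩
  have hmono : MonotoneOn F (Icc 0 R) := by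
    intro x hx y hy hxy
    by_contra! hlt
    -- A decrease produces a local maximum at `a` followed by a lower local minimum at `b`.
    obtain ⟨a, ha, hamax⟩ := isCompact_Icc.exists_isMaxOn (nonempty_Icc.2 hy.1)
      (hcont.mono (Icc_subset_Icc_right hy.2))
    have hxa : F x ≤ F a := hamax ⟨hx.1, hxy⟩
    have ha0 : 0 < a := by
      refine ha.1.lt_of_ne ?_
      rintro rfl
      linarith [(hrange y hy).1]
    have hay : a < y := by
      refine ha.2.lt_of_ne ?_
      rintro rfl
      linarith
    have haR : a ∈ Ioo 0 R := ⟨ha0, hay.trans_le hy.2⟩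
    obtain ⟨b, hb, hbmin⟩ := isCompact_Icc.exists_isMinOn (nonempty_Icc.2 haR.2.le)
      (hcont.mono (Icc_subset_Icc_left ha0.le))
    have hby : F b ≤ F y := hbmin ⟨hay.le, hy.2⟩
    have hab : a < b := by
      refine hb.1.lt_of_ne ?_
      rintro rfl
      linarith
    have hbR' : b < R := by
      refine hb.2.lt_of_ne ?_
      rintro rfl
      linarith [(hrange x hx).2]
    have hbR : b ∈ Ioo 0 R := ⟨ha0.trans hab, hbR'⟩
    have hlmax : IsLocalMax F a := hamax.isLocalMax (Icc_mem_nhds ha0 hay)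
    have hlmin : IsLocalMin F b := hbmin.isLocalMin (Icc_mem_nhds hab hbR')
    have h2a := hlmax.deriv_deriv_nonpos (hC2 a haR).continuousAt
    have h2b := hlmin.deriv_deriv_nonneg (hC2 b hbR).continuousAt
    have hFa := (hbound a haR).1
    have hFb := (hbound b hbR).1
    have oa := hODE a haR
    have ob := hODE b hbR
    rw [hlmax.deriv_eq_zero] at oa
    rw [hlmin.deriv_eq_zero] at ob
    have ka : 1 / a ^ 2 ≤ 1 - F a ^ 2 := by
      refine le_of_mul_le_mul_right ?_ hFa
      rw [one_div_mul_eq_div, ← oa]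
      linarith [zero_div a]
    have kb : 1 - F b ^ 2 ≤ 1 / b ^ 2 := by
      refine le_of_mul_le_mul_right ?_ hFb
      rw [one_div_mul_eq_div, ← ob]
      linarith [zero_div b]
    have hinv : 1 / b ^ 2 < 1 / a ^ 2 := by gcongr
    have hsq : F b ^ 2 < F a ^ 2 := by
      have : F b < F a := by linarith
      gcongr
    linarith
  refine ⟨hmono, fun r hr => ?_⟩
  rw [← derivWithin_of_mem_nhds (Icc_mem_nhds hr.1 hr.2)]
  exact hmono.derivWithin_nonneg
end
end

section
/- Let R > 0 and let F:[0,R]→ℝ be C² on [0,R] (one-sided derivatives at the endpoints) with F(0)=0, F(R)=1, 0 < F(r) < 1 and F'(r) > 0 for r ∈ (0,R), F''(r) → 0 as r → 0⁺, and F solving −F''(r) − F'(r)/r + F(r)/r² = (1−F(r)²)·F(r) on (0,R). Suppose g:[0,R]→ℝ is continuous, C¹ on [0,R], C² on (0,R), with g(0)=g(R)=0, g(r) > 0 for r ∈ (0,R), g(r)/r bounded as r → 0⁺, and suppose there is λ ∈ ℝ such that −g''(r) − g'(r)/r + g(r)/r² − (1 − 3·F(r)²)·g(r) = λ·g(r)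 on (0,R). Then λ > 0. -/
open Set Filter

noncomputable section

/-- At the right endpoint of an interval, a function that is nonnegative there and vanishes at
the endpoint has nonpositive one-sided derivative. -/
theorem derivWithin_Icc_right_nonpos {a b : ℝ} {g : ℝ → ℝ} (hab : a < b)
    (hg : DifferentiableWithinAt ℝ g (Icc a b) b) (hb : g b = 0)
    (hpos : ∀ x ∈ Ioo a b, 0 < g x) : derivWithin g (Icc a b) b ≤ 0 := by
  have h := (hasDerivWithinAt_iff_tendsto_slope' (s := Ioo a b) (by simp)).1
    (hg.hasDerivWithinAt.mono Ioo_subset_Icc_self)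
  have : (nhdsWithin b (Ioo a b)).NeBot := right_nhdsWithin_Ioo_neBot hab
  refine le_of_tendsto h ?_
  filter_upwards [self_mem_nhdsWithin] with x hx
  rw [slope_def_field, hb]
  exact div_nonpos_of_nonneg_of_nonpos (by linarith [hpos x hx]) (by linarith [hx.2])

/-- Lagrange's identity: the derivative of `r (g F' - g' F)` in terms of the radial operators. -/
theorem hasDerivAt_radial_wronskian {F g : ℝ → ℝ} {r : ℝ}
    (hF : ContDiffAt ℝ 2 F r) (hg : ContDiffAt ℝ 2 g r) :
    HasDerivAt (fun x => x * (g x * deriv F x - deriv g x * F x))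
      ((g r * deriv F r - deriv g r * F r)
        + r * (g r * deriv (deriv F) r - deriv (deriv g) r * F r)) r := by
  have key : ∀ {f : ℝ → ℝ}, ContDiffAt ℝ 2 f r →
      HasDerivAt f (deriv f r) r ∧ HasDerivAt (deriv f) (deriv (deriv f) r) r := by
    intro f hf
    refine ⟨(hf.differentiableAt (by norm_num)).hasDerivAt, ?_⟩
    have h : ContDiffAt ℝ 1 (deriv f) r := hf.derivWithin (m := 1) (by norm_num)
    exact (h.differentiableAt (by norm_num)).hasDerivAt
  obtain ⟨hF1, hF2⟩ := key hF
  obtain ⟨hg1, hg2⟩ := key hg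
  refine ((hasDerivAt_id' r).fun_mul ((hg1.fun_mul hF2).fun_sub (hg2.fun_mul hF1))).congr_deriv ?_
  ring

/-- Positivity of the first Dirichlet eigenvalue of the linearized operator
`L g = −g'' − g'/r + g/r² − (1 − 3F²)g` around the increasing profile `F` of the
degree-one equivariant Ginzburg–Landau vortex on `[0, R]`: if `g > 0` on `(0, R)`
with `g(0) = g(R) = 0`, `g(r)/r` bounded as `r → 0⁺`, and `L g = λ g`, then `λ > 0`. -/
theorem statement19 (R : ℝ) (hR : 0 < R) (F : ℝ → ℝ)
    (hFC2 : ContDiffOn ℝ 2 F (Icc 0 R))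
    (hF0 : F 0 = 0) (hFR : F R = 1)
    (hFbound : ∀ r ∈ Ioo (0 : ℝ) R, 0 < F r ∧ F r < 1)
    (hF' : ∀ r ∈ Ioo (0 : ℝ) R, 0 < deriv F r)
    (hF'' : Tendsto (fun r => deriv (deriv F) r) (nhdsWithin 0 (Ioi 0)) (nhds 0))
    (hODE : ∀ r ∈ Ioo (0 : ℝ) R,
      -(deriv (deriv F) r) - deriv F r / r + F r / r ^ 2 = (1 - (F r) ^ 2) * F r)
    (g : ℝ → ℝ) (lam : ℝ)
    (hgcont : ContinuousOn g (Icc 0 R))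
    (hgC1 : ContDiffOn ℝ 1 g (Icc 0 R))
    (hgC2 : ∀ r ∈ Ioo (0 : ℝ) R, ContDiffAt ℝ 2 g r)
    (hg0 : g 0 = 0) (hgR : g R = 0)
    (hgpos : ∀ r ∈ Ioo (0 : ℝ) R, 0 < g r)
    (hgbdd : ∃ M : ℝ, ∀ᶠ r in nhdsWithin 0 (Ioi (0 : ℝ)), |g r / r| ≤ M)
    (heig : ∀ r ∈ Ioo (0 : ℝ) R,
      -(deriv (deriv g) r) - deriv g r / r + g r / r ^ 2 - (1 - 3 * (F r) ^ 2) * g r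
        = lam * g r) :
    0 < lam := by
  by_contra! hlam
  have hu : UniqueDiffOn ℝ (Icc 0 R) := uniqueDiffOn_Icc hR
  have hRmem : R ∈ Icc 0 R := right_mem_Icc.2 hR.le
  set W : ℝ → ℝ := fun x =>
    x * (g x * derivWithin F (Icc 0 R) x - derivWithin g (Icc 0 R) x * F x) with hW
  have hWcont : ContinuousOn W (Icc 0 R) :=
    continuousOn_id.mul ((hgcont.mul (hFC2.continuousOn_derivWithin hu (by norm_num))).sub
      ((hgC1.continuousOn_derivWithin hu le_rfl).mul hFC2.continuousOn))
  have hWanti : StrictAntiOn W (Icc 0 R) := by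
    refine strictAntiOn_of_deriv_neg (convex_Icc 0 R) hWcont fun r hr => ?_
    rw [interior_Icc] at hr
    have heq : W =ᶠ[nhds r] fun x => x * (g x * deriv F x - deriv g x * F x) := by
      filter_upwards [isOpen_Ioo.mem_nhds hr] with x hx
      have hx' : Icc 0 R ∈ nhds x := Icc_mem_nhds hx.1 hx.2
      simp only [hW, derivWithin_of_mem_nhds hx']
    have hr0 := hr.1
    have hFr := (hFbound r hr).1
    have hgr := hgpos r hr
    rw [heq.deriv_eq, (hasDerivAt_radial_wronskian
      (hFC2.contDiffAt (Icc_mem_nhds hr.1 hr.2)) (hgC2 r hr)).deriv]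
    have hF2 : deriv (deriv F) r = -deriv F r / r + F r / r ^ 2 - (1 - F r ^ 2) * F r := by
      linear_combination -hODE r hr
    have hg2 : deriv (deriv g) r
        = -deriv g r / r + g r / r ^ 2 - (1 - 3 * F r ^ 2) * g r - lam * g r := by
      linear_combination -heig r hr
    have hval : (g r * deriv F r - deriv g r * F r)
        + r * (g r * deriv (deriv F) r - deriv (deriv g) r * F r)
        = r * g r * F r * lam - 2 * (r * g r * F r ^ 3) := by
      rw [hF2, hg2]
      field_simp
      ring
    rw [hval]
    have h1 : r * g r * F r * lam ≤ 0 := mul_nonpos_of_nonneg_of_nonpos (by positivity) hlam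
    have h2 : 0 < r * g r * F r ^ 3 := by positivity
    linarith
  have hWR : W R < W 0 := hWanti (left_mem_Icc.2 hR.le) hRmem hR
  have hgR' : derivWithin g (Icc 0 R) R ≤ 0 :=
    derivWithin_Icc_right_nonpos hR (hgC1.differentiableOn one_ne_zero R hRmem) hgR hgpos
  simp only [hW, hgR, hFR, zero_mul, zero_sub, mul_one] at hWR
  nlinarith
end
end
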